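/- arXiv:2411.09005 — 7 statements merged into one kernel-verified Lean document; each statement's English description precedes it below -/
import Mathlib

section
/- Suppose α=λ=μ>0 and ν>0. Then for all integers n,k≥0 and all t≥0 the Adomian series components satisfy p_k(n,t) = (−1)^{k−n} c_{n,k} (λ t^ν)^k / Γ(kν+1) when k≥n, and p_k(n,t)=0 when k<n. -/
open MeasureTheory

/-- Riemann–Liouville fractional integral of order `ν`. -/
noncomputable def fracInt (ν : ℝ) (f : ℝ → ℝ) (t : ℝ) : ℝ :=
  (1 / Real.Gamma ν) * ∫ s in (0:ℝ)..t, (t - s) ^ (ν - 1) * f s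

/-- Adomian series components `p_k(n,·)` of the time-fractional linear
birth–death process with immigration at extinction. -/
noncomputable def adomianP (ν α lam μ : ℝ) : ℕ → ℕ → ℝ → ℝ
  | 0, 0 => fun _ => 1
  | 0, _ + 1 => fun _ => 0
  | k + 1, 0 => fracInt ν (fun s =>
      -α * adomianP ν α lam μ k 0 s + μ * adomianP ν α lam μ k 1 s)
  | k + 1, 1 => fracInt ν (fun s =>
      -(lam + μ) * adomianP ν α lam μ k 1 s + α * adomianP ν α lam μ k 0 s
        + 2 * μ * adomianP ν α lam μ k 2 s)
  | k + 1, n + 2 => fracInt ν (fun s =>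
      -(((n : ℝ) + 2) * (lam + μ)) * adomianP ν α lam μ k (n + 2) s
        + ((n : ℝ) + 1) * lam * adomianP ν α lam μ k (n + 1) s
        + ((n : ℝ) + 3) * μ * adomianP ν α lam μ k (n + 3) s)

/-- The integer coefficients `c_{n,k}`. -/
def cCoef : ℕ → ℕ → ℤ
  | 0, 0 => 1
  | _ + 1, 0 => 0
  | 0, k + 1 => cCoef 0 k + cCoef 1 k
  | 1, k + 1 => cCoef 0 k + 2 * (cCoef 1 k + cCoef 2 k)
  | n + 2, k + 1 => ((n : ℤ) + 1) * cCoef (n + 1) k + 2 * ((n : ℤ) + 2) * cCoef (n + 2) k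
      + ((n : ℤ) + 3) * cCoef (n + 3) k

theorem aux_int (ν b t : ℝ) (hν : 0 < ν) (hb : 0 < b) (ht : 0 < t) :
    ∫ s in (0:ℝ)..t, (t - s) ^ (ν - 1) * s ^ (b - 1) =
      t ^ (b + ν - 1) * (Real.Gamma b * Real.Gamma ν / Real.Gamma (b + ν)) := by
  have h := Complex.betaIntegral_scaled (b : ℂ) (ν : ℂ) ht
  rw [Complex.betaIntegral_eq_Gamma_mul_div _ _ (by simpa using hb) (by simpa using hν)] at h
  have h2 : ∫ x in (0:ℝ)..t, (x:ℂ) ^ ((b:ℂ) - 1) * ((t:ℂ) - x) ^ ((ν:ℂ) - 1) =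
      ∫ x in (0:ℝ)..t, (((t - x) ^ (ν - 1) * x ^ (b - 1) : ℝ) : ℂ) := by
    apply intervalIntegral.integral_congr
    intro x hx
    rw [Set.uIcc_of_le ht.le] at hx
    simp only
    rw [Complex.ofReal_mul, Complex.ofReal_cpow (sub_nonneg.2 hx.2), Complex.ofReal_cpow hx.1]
    push_cast
    ring
  rw [h2, intervalIntegral.integral_ofReal] at h
  apply Complex.ofReal_injective
  rw [h]
  rw [Complex.ofReal_mul, Complex.ofReal_cpow ht.le]
  push_cast
  simp only [Complex.Gamma_ofReal, ← Complex.ofReal_add]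

theorem fracInt_pow (ν : ℝ) (hν : 0 < ν) (k : ℕ) (a : ℝ) (f : ℝ → ℝ)
    (hf : ∀ s, 0 ≤ s → f s = a * (s ^ ν) ^ k / Real.Gamma ((k : ℝ) * ν + 1))
    (t : ℝ) (ht : 0 ≤ t) :
    fracInt ν f t = a * (t ^ ν) ^ (k + 1) / Real.Gamma (((k + 1 : ℕ) : ℝ) * ν + 1) := by
  unfold fracInt
  rcases ht.eq_or_lt with rfl | ht
  · simp [Real.zero_rpow hν.ne']
  have hk : 0 < (k : ℝ) * ν + 1 := by positivity
  have h1 : ∫ s in (0:ℝ)..t, (t - s) ^ (ν - 1) * f s =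
      ∫ s in (0:ℝ)..t, (a / Real.Gamma ((k : ℝ) * ν + 1)) *
        ((t - s) ^ (ν - 1) * s ^ (((k : ℝ) * ν + 1) - 1)) := by
    apply intervalIntegral.integral_congr
    intro s hs
    rw [Set.uIcc_of_le ht.le] at hs
    simp only
    rw [hf s hs.1, add_sub_cancel_right, mul_comm (k : ℝ) ν, Real.rpow_mul_natCast hs.1]
    ring
  rw [h1, intervalIntegral.integral_const_mul, aux_int ν _ t hν hk ht]
  have e1 : (k : ℝ) * ν + 1 + ν - 1 = ν * ((k + 1 : ℕ) : ℝ) := by push_cast; ring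
  have e2 : (k : ℝ) * ν + 1 + ν = ((k + 1 : ℕ) : ℝ) * ν + 1 := by push_cast; ring
  rw [e1, e2, Real.rpow_mul_natCast ht.le]
  have g1 := (Real.Gamma_pos_of_pos hν).ne'
  have g2 := (Real.Gamma_pos_of_pos hk).ne'
  field_simp

theorem cCoef_zero (k : ℕ) : ∀ n, k < n → cCoef n k = 0 := by
  induction k with
  | zero => intro n hn; obtain ⟨m, rfl⟩ := Nat.exists_eq_succ_of_ne_zero hn.ne'; simp [cCoef]
  | succ k ih =>
    intro n hn
    match n, hn with
    | n + 2, hn =>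
      rw [cCoef, ih _ (by omega), ih _ (by omega), ih _ (by omega)]; simp

theorem adomianP_unif (ν lam : ℝ) (hν : 0 < ν) (k : ℕ) : ∀ (n : ℕ) (t : ℝ), 0 ≤ t →
    adomianP ν lam lam lam k n t =
      ((-1 : ℝ) ^ (k + n) * (cCoef n k : ℝ) * lam ^ k) * (t ^ ν) ^ k /
        Real.Gamma ((k : ℝ) * ν + 1) := by
  induction k with
  | zero =>
    intro n t ht
    match n with
    | 0 => simp [adomianP, cCoef]
    | n + 1 => simp [adomianP, cCoef]
  | succ k ih =>
    intro n t ht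
    match n with
    | 0 =>
      rw [adomianP]
      apply fracInt_pow ν hν k _ _ _ t ht
      intro s hs
      rw [ih _ s hs, ih _ s hs, cCoef]
      push_cast
      ring
    | 1 =>
      rw [adomianP]
      apply fracInt_pow ν hν k _ _ _ t ht
      intro s hs
      rw [ih _ s hs, ih _ s hs, ih _ s hs, cCoef]
      push_cast
      ring
    | n + 2 =>
      rw [adomianP]
      apply fracInt_pow ν hν k _ _ _ t ht
      intro s hs
      rw [ih _ s hs, ih _ s hs, ih _ s hs, cCoef]
      push_cast
      ring

/-- For `α = λ = μ`, the Adomian series components are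
`p_k(n,t) = (−1)^{k−n} c_{n,k} (λ t^ν)^k / Γ(kν+1)` for `k ≥ n`, and `0` for `k < n`. -/
theorem adomianP_eq (ν lam : ℝ) (hν : 0 < ν) (hlam : 0 < lam)
    (n k : ℕ) (t : ℝ) (ht : 0 ≤ t) :
    (n ≤ k → adomianP ν lam lam lam k n t =
      (-1 : ℝ) ^ (k - n) * (cCoef n k : ℝ) * (lam * t ^ ν) ^ k /
        Real.Gamma ((k : ℝ) * ν + 1)) ∧
    (k < n → adomianP ν lam lam lam k n t = 0) := by
  rw [adomianP_unif ν lam hν k n t ht]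
  constructor
  · intro h
    have e : (-1 : ℝ) ^ (k + n) = (-1) ^ (k - n) := by
      obtain ⟨m, rfl⟩ := Nat.exists_eq_add_of_le h
      rw [Nat.add_sub_cancel_left, show n + m + n = 2 * n + m by ring, pow_add, pow_mul]
      simp
    rw [e, mul_pow]
    ring
  · intro h
    simp [cCoef_zero k n h]
end

section
/- Let ν>0, α>0, λ>0 with rλ≠α for every positive integer r. Then the Adomian series components of the time-fractional linear birth process with immigration satisfy, for all t≥0: p̄_k(0,t) = (−α t^ν)^k/Γ(kν+1) for all k≥0; p̄_k(n,t) = ∑_{r=1}^{n} (−1)^{r+k} C(n−1,r−1) α((rλ)^k − α^k) t^{kν} / ((rλ−α) Γ(kν+1)) for all n≥1 and k≥n; and p̄_k(n,t)=0 whenever n≥k+1. -/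
open MeasureTheory

/-- Adomian series components `p̄_k(n,·)` of the time-fractional linear
birth process with immigration. -/
noncomputable def adomianB (ν α lam : ℝ) : ℕ → ℕ → ℝ → ℝ
  | 0, 0 => fun _ => 1
  | 0, _ + 1 => fun _ => 0
  | k + 1, 0 => fracInt ν (fun s => -α * adomianB ν α lam k 0 s)
  | k + 1, 1 => fracInt ν (fun s =>
      -lam * adomianB ν α lam k 1 s + α * adomianB ν α lam k 0 s)
  | k + 1, n + 2 => fracInt ν (fun s =>
      -(((n : ℝ) + 2) * lam) * adomianB ν α lam k (n + 2) s
        + ((n : ℝ) + 1) * lam * adomianB ν α lam k (n + 1) s)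


lemma fracInt_pow_aux (ν c b : ℝ) (hν : 0 < ν) (hb : 0 ≤ b) (f : ℝ → ℝ)
    (hf : ∀ s, 0 ≤ s → f s = c * (s ^ b / Real.Gamma (b + 1))) (t : ℝ) (ht : 0 ≤ t) :
    fracInt ν f t = c * (t ^ (b + ν) / Real.Gamma (b + ν + 1)) := by
  have hG : Real.Gamma ν ≠ 0 := (Real.Gamma_pos_of_pos hν).ne'
  have hG2 : Real.Gamma (b + 1) ≠ 0 := (Real.Gamma_pos_of_pos (by linarith)).ne'
  rcases ht.eq_or_lt with rfl | htpos
  · simp [fracInt, Real.zero_rpow (by positivity : b + ν ≠ 0)]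
  have key : ∫ s in (0:ℝ)..t, s ^ b * (t - s) ^ (ν - 1)
      = t ^ (b + ν) * (Real.Gamma (b + 1) * Real.Gamma ν / Real.Gamma (b + 1 + ν)) := by
    have h1 := Complex.betaIntegral_scaled ((b + 1 : ℝ) : ℂ) (ν : ℂ) htpos
    rw [Complex.betaIntegral_eq_Gamma_mul_div _ _ (by simp; linarith) (by simpa),
      ← Complex.ofReal_add, Complex.Gamma_ofReal, Complex.Gamma_ofReal, Complex.Gamma_ofReal] at h1
    have h2 : ∫ x in (0:ℝ)..t, (x : ℂ) ^ (((b + 1 : ℝ) : ℂ) - 1) * ((t : ℂ) - x) ^ ((ν : ℂ) - 1)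
        = ∫ x in (0:ℝ)..t, ((x ^ b * (t - x) ^ (ν - 1) : ℝ) : ℂ) := by
      apply intervalIntegral.integral_congr
      intro x hx
      rw [Set.uIcc_of_le ht] at hx
      simp only
      rw [Complex.ofReal_mul, Complex.ofReal_cpow hx.1, Complex.ofReal_cpow (by linarith [hx.2])]
      push_cast
      congr 2
      ring
    rw [h2, intervalIntegral.integral_ofReal] at h1
    have h3 : (t : ℂ) ^ (((b + 1 + ν : ℝ) : ℂ) - 1) = ((t ^ (b + ν) : ℝ) : ℂ) := by
      rw [Complex.ofReal_cpow ht]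
      congr 1
      push_cast
      ring
    rw [h3] at h1
    exact_mod_cast h1
  have h4 : ∫ s in (0:ℝ)..t, (t - s) ^ (ν - 1) * f s
      = ∫ s in (0:ℝ)..t, (c / Real.Gamma (b + 1)) * (s ^ b * (t - s) ^ (ν - 1)) := by
    apply intervalIntegral.integral_congr
    intro x hx
    rw [Set.uIcc_of_le ht] at hx
    simp only
    rw [hf x hx.1]
    ring
  rw [fracInt, h4, intervalIntegral.integral_const_mul, key,
    show b + 1 + ν = b + ν + 1 by ring]
  field_simp

/-- closed-form coefficient -/
noncomputable def coefB (α lam : ℝ) (k m : ℕ) : ℝ :=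
  ∑ j ∈ Finset.range (m + 1), (-1 : ℝ) ^ (j + 1 + k) * (m.choose j : ℝ) *
    (α * (((((j : ℝ) + 1) * lam) ^ k - α ^ k) / (((j : ℝ) + 1) * lam - α)))

lemma coefB_h (x α : ℝ) (h : x - α ≠ 0) (k : ℕ) :
    (x ^ (k + 1) - α ^ (k + 1)) / (x - α) = x * ((x ^ k - α ^ k) / (x - α)) + α ^ k := by
  field_simp
  ring

lemma coefB_one (α lam : ℝ) (hne : ∀ j : ℕ, ((j : ℝ) + 1) * lam - α ≠ 0) (k : ℕ) :
    coefB α lam (k + 1) 0 = -lam * coefB α lam k 0 + α * (-α) ^ k := by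
  have := hne 0
  simp only [coefB, zero_add, Finset.sum_range_one]
  rw [coefB_h _ _ this]
  rw [neg_pow α k]
  simp
  ring

lemma coefB_succ (α lam : ℝ) (hne : ∀ j : ℕ, ((j : ℝ) + 1) * lam - α ≠ 0) (k m : ℕ) :
    coefB α lam (k + 1) (m + 1) =
      -(((m : ℝ) + 2) * lam) * coefB α lam k (m + 1) + ((m : ℝ) + 1) * lam * coefB α lam k m := by
  have hext : coefB α lam k m = ∑ j ∈ Finset.range (m + 1 + 1),
      (-1 : ℝ) ^ (j + 1 + k) * (m.choose j : ℝ) *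
      (α * (((((j : ℝ) + 1) * lam) ^ k - α ^ k) / (((j : ℝ) + 1) * lam - α))) := by
    rw [Finset.sum_range_succ _ (m + 1)]
    simp [coefB]
  have halt : ∑ j ∈ Finset.range (m + 1 + 1), ((-1 : ℝ) ^ j * ((m + 1).choose j : ℝ)) = 0 := by
    have := Int.alternating_sum_range_choose_of_ne (n := m + 1) (by omega)
    exact_mod_cast this
  rw [hext, coefB, coefB, Finset.mul_sum, Finset.mul_sum, ← Finset.sum_add_distrib]
  rw [← sub_eq_zero, ← Finset.sum_sub_distrib]
  rw [← mul_zero ((-1 : ℝ) ^ k * α * α ^ k), ← halt, Finset.mul_sum]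
  apply Finset.sum_congr rfl
  intro j hj
  have hj' : j ≤ m + 1 := by simpa [Nat.lt_succ_iff] using hj
  have hc : (m.choose j : ℝ) * ((m : ℝ) + 1) = ((m + 1).choose j : ℝ) * ((m : ℝ) + 1 - j) := by
    have := Nat.choose_mul_succ_eq m j
    have h2 : ((m + 1 - j : ℕ) : ℝ) = (m : ℝ) + 1 - j := by
      rw [Nat.cast_sub hj']; push_cast; ring
    rw [← h2]
    exact_mod_cast this
  rw [coefB_h _ _ (hne j)]
  generalize (((((j : ℝ) + 1) * lam) ^ k - α ^ k) / (((j : ℝ) + 1) * lam - α)) = H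
  simp only [pow_add, pow_one]
  linear_combination ((-1 : ℝ) ^ j * (-1) ^ k * α * H * lam) * hc

lemma adomianB_zero_aux (ν α lam : ℝ) (hν : 0 < ν) (k : ℕ) : ∀ t : ℝ, 0 ≤ t →
    adomianB ν α lam k 0 t =
      (-α) ^ k * (t ^ ((k : ℝ) * ν) / Real.Gamma ((k : ℝ) * ν + 1)) := by
  induction k with
  | zero => intro t ht; simp [adomianB]
  | succ k ih =>
    intro t ht
    rw [adomianB, fracInt_pow_aux ν ((-α) ^ (k + 1)) ((k : ℝ) * ν) hν (by positivity) _ _ t ht]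
    · push_cast
      rw [add_mul, one_mul]
    · intro s hs
      rw [ih s hs]
      ring

lemma adomianB_succ_aux (ν α lam : ℝ) (hν : 0 < ν)
    (hne : ∀ j : ℕ, ((j : ℝ) + 1) * lam - α ≠ 0) (k : ℕ) : ∀ (m : ℕ) (t : ℝ), 0 ≤ t →
    adomianB ν α lam k (m + 1) t =
      coefB α lam k m * (t ^ ((k : ℝ) * ν) / Real.Gamma ((k : ℝ) * ν + 1)) := by
  induction k with
  | zero => intro m t ht; simp [adomianB, coefB]
  | succ k ih =>
    intro m t ht
    rcases m with _ | m
    · rw [adomianB, fracInt_pow_aux ν (coefB α lam (k + 1) 0) ((k : ℝ) * ν) hν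
        (by positivity) _ _ t ht]
      · push_cast
        rw [add_mul, one_mul]
      · intro s hs
        rw [ih 0 s hs, adomianB_zero_aux ν α lam hν k s hs, coefB_one α lam hne]
        ring
    · rw [adomianB, fracInt_pow_aux ν (coefB α lam (k + 1) (m + 1)) ((k : ℝ) * ν) hν
        (by positivity) _ _ t ht]
      · push_cast
        rw [add_mul, one_mul]
      · intro s hs
        rw [ih (m + 1) s hs, ih m s hs, coefB_succ α lam hne]
        ring

lemma coefB_eq_zero (α lam : ℝ) (hne : ∀ j : ℕ, ((j : ℝ) + 1) * lam - α ≠ 0) (k : ℕ) :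
    ∀ m : ℕ, k ≤ m → coefB α lam k m = 0 := by
  induction k with
  | zero => intro m _; simp [coefB]
  | succ k ih =>
    intro m hm
    obtain ⟨m, rfl⟩ : ∃ m', m = m' + 1 := ⟨m - 1, by omega⟩
    rw [coefB_succ α lam hne, ih (m + 1) (by omega), ih m (by omega)]
    ring

/-- Explicit form of the Adomian series components of the TFLBPwI. -/
theorem adomianB_eq (ν α lam : ℝ) (hν : 0 < ν) (hα : 0 < α) (hlam : 0 < lam)
    (hne : ∀ r : ℕ, 1 ≤ r → (r : ℝ) * lam ≠ α) (t : ℝ) (ht : 0 ≤ t) :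
    (∀ k : ℕ, adomianB ν α lam k 0 t = (-α * t ^ ν) ^ k / Real.Gamma ((k : ℝ) * ν + 1)) ∧
    (∀ n k : ℕ, 1 ≤ n → n ≤ k →
      adomianB ν α lam k n t = ∑ r ∈ Finset.Icc 1 n,
        (-1 : ℝ) ^ (r + k) * ((n - 1).choose (r - 1) : ℝ) *
          (α * (((r : ℝ) * lam) ^ k - α ^ k) * t ^ ((k : ℝ) * ν)) /
          (((r : ℝ) * lam - α) * Real.Gamma ((k : ℝ) * ν + 1))) ∧
    (∀ n k : ℕ, k + 1 ≤ n → adomianB ν α lam k n t = 0) := by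
  have hne' : ∀ j : ℕ, ((j : ℝ) + 1) * lam - α ≠ 0 := by
    intro j
    have := hne (j + 1) (by omega)
    push_cast at this
    exact sub_ne_zero.mpr this
  refine ⟨?_, ?_, ?_⟩
  · intro k
    rw [adomianB_zero_aux ν α lam hν k t ht, mul_pow, ← Real.rpow_natCast (t ^ ν) k,
      ← Real.rpow_mul ht, mul_comm ν, mul_div_assoc]
  · intro n k hn _
    obtain ⟨m, rfl⟩ : ∃ m', n = m' + 1 := ⟨n - 1, by omega⟩
    rw [adomianB_succ_aux ν α lam hν hne' k m t ht, coefB, Finset.sum_mul,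
      Finset.range_eq_Ico]
    have : Finset.Icc 1 (m + 1) = Finset.Ico (0 + 1) (m + 1 + 1) := by
      ext; simp [Nat.lt_succ_iff]
    rw [this, ← Finset.sum_Ico_add']
    apply Finset.sum_congr rfl
    intro j _
    simp only [Nat.add_sub_cancel]
    push_cast
    rw [mul_div_assoc, mul_div_mul_comm]
    ring
  · intro n k hnk
    obtain ⟨m, rfl⟩ : ∃ m', n = m' + 1 := ⟨n - 1, by omega⟩
    rw [adomianB_succ_aux ν α lam hν hne' k m t ht, coefB_eq_zero α lam hne' k m (by omega),
      zero_mul]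
end

section
/- Let 0<ν≤1, α>0, λ>0 with rλ≠α for every positive integer r. Then for every integer n≥1 and every t≥0, ∑_{k=n}^{∞} ∑_{r=1}^{n} (−1)^{r+k} C(n−1,r−1) α((rλ)^k − α^k) t^{kν} / ((rλ−α) Γ(kν+1)) = ∑_{r=1}^{n} (−1)^r C(n−1,r−1) (α/(rλ−α)) (E_ν(−rλ t^ν) − E_ν(−α t^ν)), where the outer series on the left converges. -/
/-- The Mittag-Leffler function `E_ν(x) = ∑_{k≥0} x^k / Γ(kν+1)`. -/
noncomputable def ML (ν x : ℝ) : ℝ := ∑' k : ℕ, x ^ k / Real.Gamma ((k : ℝ) * ν + 1)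

lemma ml_gamma_step (ν x : ℝ) (hν : 0 < ν) (hx : 1 < x) :
    (x - 1) ^ ν * Real.Gamma x ≤ Real.Gamma (x + ν) := by
  have h := Real.convexOn_log_Gamma.slope_mono_adjacent (x := x - 1) (y := x) (z := x + ν)
    (by simp; linarith) (by simp; linarith) (by linarith) (by linarith)
  have hG : Real.Gamma x = (x - 1) * Real.Gamma (x - 1) := by
    have := Real.Gamma_add_one (s := x - 1) (by linarith)
    simpa using this
  have p1 : 0 < Real.Gamma (x - 1) := Real.Gamma_pos_of_pos (by linarith)
  have p2 : 0 < Real.Gamma x := Real.Gamma_pos_of_pos (by linarith)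
  have p3 : 0 < Real.Gamma (x + ν) := Real.Gamma_pos_of_pos (by linarith)
  have p4 : 0 < x - 1 := by linarith
  have hl : Real.log (Real.Gamma x) = Real.log (x - 1) + Real.log (Real.Gamma (x - 1)) := by
    rw [hG, Real.log_mul p4.ne' p1.ne']
  simp only [Function.comp_apply] at h
  have e1 : x - (x - 1) = 1 := by ring
  have e2 : x + ν - x = ν := by ring
  rw [e1, e2, div_one, le_div_iff₀ hν] at h
  have p5 : 0 < (x - 1) ^ ν := Real.rpow_pos_of_pos p4 _
  rw [← Real.log_le_log_iff (by positivity) p3, Real.log_mul p5.ne' p2.ne', Real.log_rpow p4]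
  rw [hl] at h ⊢
  linarith

lemma ml_summable (ν x : ℝ) (hν : 0 < ν) :
    Summable (fun k : ℕ => x ^ k / Real.Gamma ((k : ℝ) * ν + 1)) := by
  apply summable_of_ratio_norm_eventually_le (r := 1 / 2) (by norm_num)
  have ht : Filter.Tendsto (fun k : ℕ => ((k : ℝ) * ν) ^ ν) Filter.atTop Filter.atTop :=
    (tendsto_rpow_atTop hν).comp (tendsto_natCast_atTop_atTop.atTop_mul_const hν)
  filter_upwards [ht.eventually_ge_atTop (2 * |x|), Filter.eventually_gt_atTop 0] with k hk hk0
  have hkp : 0 < (k : ℝ) * ν := by positivity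
  have h := ml_gamma_step ν ((k : ℝ) * ν + 1) hν (by linarith)
  have e : ((k + 1 : ℕ) : ℝ) * ν + 1 = (k : ℝ) * ν + 1 + ν := by push_cast; ring
  rw [e]
  have p2 : 0 < Real.Gamma ((k : ℝ) * ν + 1) := Real.Gamma_pos_of_pos (by linarith)
  have p3 : 0 < Real.Gamma ((k : ℝ) * ν + 1 + ν) := Real.Gamma_pos_of_pos (by linarith)
  rw [add_sub_cancel_right] at h
  have h2 : 2 * |x| * Real.Gamma ((k : ℝ) * ν + 1) ≤ Real.Gamma ((k : ℝ) * ν + 1 + ν) :=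
    le_trans (mul_le_mul_of_nonneg_right hk p2.le) h
  rw [norm_div, norm_div, norm_pow, norm_pow, Real.norm_eq_abs, Real.norm_of_nonneg p2.le,
    Real.norm_of_nonneg p3.le, div_le_iff₀ p3, pow_succ]
  have h3 : 0 ≤ |x| ^ k / Real.Gamma ((k : ℝ) * ν + 1) := by positivity
  calc |x| ^ k * |x| = 1 / 2 * (|x| ^ k / Real.Gamma ((k : ℝ) * ν + 1)) *
        (2 * |x| * Real.Gamma ((k : ℝ) * ν + 1)) := by field_simp
    _ ≤ _ := mul_le_mul_of_nonneg_left h2 (by positivity)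

lemma ml_sum_pow (N i : ℕ) (hi : i < N) :
    ∑ r ∈ Finset.Icc 1 (N + 1), (-1 : ℝ) ^ r * (N.choose (r - 1) : ℝ) * (r : ℝ) ^ i = 0 := by
  have h := congrFun (fwdDiff_iter_pow_eq_zero_of_lt (R := ℝ) hi) 1
  rw [fwdDiff_iter_eq_sum_shift] at h
  have h2 : ∑ r ∈ Finset.Icc 1 (N + 1), (-1 : ℝ) ^ r * (N.choose (r - 1) : ℝ) * (r : ℝ) ^ i
      = ∑ m ∈ Finset.range (N + 1), (-1 : ℝ) ^ (m + 1) * (N.choose m : ℝ) * (1 + m : ℝ) ^ i := by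
    rw [Finset.range_eq_Ico, ← Finset.Ico_add_one_right_eq_Icc,
      Finset.sum_Ico_eq_sum_range, Finset.range_eq_Ico]
    refine Finset.sum_congr (by simp) fun m _ => ?_
    simp [add_comm]
  rw [h2]
  have h3 : ∑ m ∈ Finset.range (N + 1), (-1 : ℝ) ^ (m + 1) * (N.choose m : ℝ) * (1 + m : ℝ) ^ i
    = (-1) ^ (N + 1) * ∑ k ∈ Finset.range (N + 1),
      ((-1 : ℤ) ^ (N - k) * N.choose k) • (fun r : ℝ => r ^ i) (1 + k • (1 : ℝ)) := by
    rw [Finset.mul_sum]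
    refine Finset.sum_congr rfl fun m hm => ?_
    obtain ⟨d, rfl⟩ := Nat.exists_eq_add_of_le (Nat.lt_succ_iff.mp (Finset.mem_range.mp hm))
    simp only [add_tsub_cancel_left, zsmul_eq_mul, nsmul_eq_mul, mul_one]
    push_cast
    have : (-1 : ℝ) ^ (m + d + 1) * (-1) ^ d = (-1) ^ (m + 1) := by
      rw [← pow_add, show m + d + 1 + d = m + 1 + 2 * d by ring, pow_add, pow_mul]; simp
    rw [← this]; ring
  rw [h3, h]; simp

lemma ml_vanish (α lam : ℝ) (hne : ∀ r : ℕ, 1 ≤ r → (r : ℝ) * lam ≠ α) (N k : ℕ)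
    (hk : k ≤ N) :
    ∑ r ∈ Finset.Icc 1 (N + 1), (-1 : ℝ) ^ r * (N.choose (r - 1) : ℝ) *
      ((((r : ℝ) * lam) ^ k - α ^ k) / ((r : ℝ) * lam - α)) = 0 := by
  have h1 : ∀ r ∈ Finset.Icc 1 (N + 1), (-1 : ℝ) ^ r * (N.choose (r - 1) : ℝ) *
      ((((r : ℝ) * lam) ^ k - α ^ k) / ((r : ℝ) * lam - α)) =
      ∑ i ∈ Finset.range k, ((-1 : ℝ) ^ r * (N.choose (r - 1) : ℝ) * (r : ℝ) ^ i) *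
        (lam ^ i * α ^ (k - 1 - i)) := by
    intro r hr
    have hd : (r : ℝ) * lam - α ≠ 0 := sub_ne_zero.mpr (hne r (Finset.mem_Icc.mp hr).1)
    rw [← (Commute.all ((r : ℝ) * lam) α).geom_sum₂_mul, mul_div_assoc, div_self hd, mul_one,
      Finset.mul_sum]
    refine Finset.sum_congr rfl fun i _ => ?_
    rw [mul_pow]; ring
  rw [Finset.sum_congr rfl h1, Finset.sum_comm]
  refine Finset.sum_eq_zero fun i hi => ?_
  rw [← Finset.sum_mul, ml_sum_pow N i (by have := Finset.mem_range.mp hi; omega), zero_mul]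

/-- Summing the Adomian series components of the TFLBPwI over `k ≥ n` yields the
closed form of the state probability `p̄(n,t)` in terms of Mittag-Leffler functions. -/
theorem sum_adomian_series_components (ν α lam : ℝ) (hν0 : 0 < ν) (hν1 : ν ≤ 1)
    (hα : 0 < α) (hlam : 0 < lam) (hne : ∀ r : ℕ, 1 ≤ r → (r : ℝ) * lam ≠ α)
    (n : ℕ) (hn : 1 ≤ n) (t : ℝ) (ht : 0 ≤ t) :
    HasSum (fun j : ℕ =>
      ∑ r ∈ Finset.Icc 1 n,
        (-1 : ℝ) ^ (r + (j + n)) * ((n - 1).choose (r - 1) : ℝ) *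
          (α * (((r : ℝ) * lam) ^ (j + n) - α ^ (j + n)) * t ^ (((j + n : ℕ) : ℝ) * ν)) /
          (((r : ℝ) * lam - α) * Real.Gamma (((j + n : ℕ) : ℝ) * ν + 1)))
      (∑ r ∈ Finset.Icc 1 n,
        (-1 : ℝ) ^ r * ((n - 1).choose (r - 1) : ℝ) * (α / ((r : ℝ) * lam - α)) *
          (ML ν (-((r : ℝ) * lam) * t ^ ν) - ML ν (-α * t ^ ν))) := by
  have key : HasSum (fun k : ℕ =>
      ∑ r ∈ Finset.Icc 1 n,
        (-1 : ℝ) ^ (r + k) * ((n - 1).choose (r - 1) : ℝ) *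
          (α * (((r : ℝ) * lam) ^ k - α ^ k) * t ^ ((k : ℝ) * ν)) /
          (((r : ℝ) * lam - α) * Real.Gamma ((k : ℝ) * ν + 1)))
      (∑ r ∈ Finset.Icc 1 n,
        (-1 : ℝ) ^ r * ((n - 1).choose (r - 1) : ℝ) * (α / ((r : ℝ) * lam - α)) *
          (ML ν (-((r : ℝ) * lam) * t ^ ν) - ML ν (-α * t ^ ν))) := by
    refine hasSum_sum fun r _ => ?_
    have h := (((ml_summable ν (-((r : ℝ) * lam) * t ^ ν) hν0).hasSum.sub
      (ml_summable ν (-α * t ^ ν) hν0).hasSum).mul_left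
      ((-1 : ℝ) ^ r * ((n - 1).choose (r - 1) : ℝ) * (α / ((r : ℝ) * lam - α))))
    refine h.congr_fun ?_
    intro k
    have e : t ^ ((k : ℝ) * ν) = (t ^ ν) ^ k := by
      rw [mul_comm, Real.rpow_mul_natCast ht]
    rw [e, mul_pow (-((r : ℝ) * lam)), mul_pow (-α), neg_pow ((r : ℝ) * lam), neg_pow α, pow_add]
    simp only [div_eq_mul_inv, mul_inv]
    ring
  have hz : ∑ k ∈ Finset.range n, (∑ r ∈ Finset.Icc 1 n,
        (-1 : ℝ) ^ (r + k) * ((n - 1).choose (r - 1) : ℝ) *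
          (α * (((r : ℝ) * lam) ^ k - α ^ k) * t ^ ((k : ℝ) * ν)) /
          (((r : ℝ) * lam - α) * Real.Gamma ((k : ℝ) * ν + 1))) = 0 := by
    refine Finset.sum_eq_zero fun k hk => ?_
    obtain ⟨N, rfl⟩ := Nat.exists_eq_add_of_le' hn
    have hv := ml_vanish α lam hne N k (by have := Finset.mem_range.mp hk; omega)
    rw [← mul_zero ((-1) ^ k * α * t ^ ((k : ℝ) * ν) * (Real.Gamma ((k : ℝ) * ν + 1))⁻¹), ← hv,
      Finset.mul_sum]
    refine Finset.sum_congr rfl fun r _ => ?_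
    rw [add_tsub_cancel_right, pow_add]
    simp only [div_eq_mul_inv, mul_inv]
    ring
  rw [← hasSum_nat_add_iff' n, hz, sub_zero] at key
  exact key
end

section
/- Let ν>0, c∈ℝ and z>0 satisfy |c|<z^ν. Then ∫_0^∞ e^{−zx} E_ν(c x^ν) dx = z^{ν−1}/(z^ν − c). -/
open MeasureTheory

/-- Laplace transform of the Mittag-Leffler function:
`∫_0^∞ e^{−zx} E_ν(c x^ν) dx = z^{ν−1}/(z^ν − c)` for `|c| < z^ν`. -/
theorem laplace_mittagLeffler (ν c z : ℝ) (hν : 0 < ν) (hz : 0 < z) (hc : |c| < z ^ ν) :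
    ∫ x in Set.Ioi (0:ℝ), Real.exp (-z * x) * ML ν (c * x ^ ν) =
      z ^ (ν - 1) / (z ^ ν - c) := by
  have hzν : 0 < z ^ ν := Real.rpow_pos_of_pos hz ν
  have hint : ∀ k : ℕ, IntegrableOn (fun x : ℝ => x ^ ((k:ℝ) * ν) * Real.exp (-z * x))
      (Set.Ioi 0) := by
    intro k
    have h := integrableOn_rpow_mul_exp_neg_mul_rpow (p := 1) (s := (k:ℝ) * ν) (b := z)
      (by have : 0 ≤ (k:ℝ) * ν := by positivity
          linarith) one_pos hz
    simpa only [Real.rpow_one] using h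
  have hG : ∀ k : ℕ, 0 < Real.Gamma ((k:ℝ) * ν + 1) := fun k =>
    Real.Gamma_pos_of_pos (by positivity)
  have hval : ∀ k : ℕ, ∫ x in Set.Ioi (0:ℝ), x ^ ((k:ℝ) * ν) * Real.exp (-z * x) =
      z⁻¹ * ((z ^ ν)⁻¹) ^ k * Real.Gamma ((k:ℝ) * ν + 1) := by
    intro k
    have h := Real.integral_rpow_mul_exp_neg_mul_Ioi (a := (k:ℝ) * ν + 1) (r := z)
      (by positivity) hz
    simp only [add_sub_cancel_right, ← neg_mul] at h
    rw [h, one_div, Real.rpow_add (inv_pos.2 hz), Real.rpow_one, mul_comm (k:ℝ) ν,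
      Real.rpow_mul_natCast (inv_pos.2 hz).le, Real.inv_rpow hz.le]
    ring
  have key := integral_tsum_of_summable_integral_norm (μ := volume.restrict (Set.Ioi (0:ℝ)))
    (F := fun (k : ℕ) (x : ℝ) => (c ^ k / Real.Gamma ((k:ℝ) * ν + 1)) *
      (x ^ ((k:ℝ) * ν) * Real.exp (-z * x))) (fun k => (hint k).const_mul _) (by
      have hs : Summable fun k : ℕ => z⁻¹ * (|c| / z ^ ν) ^ k :=
        (summable_geometric_of_lt_one (by positivity) ((div_lt_one hzν).2 hc)).mul_left _
      refine hs.congr fun k => ?_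
      have h1 : ∫ x in Set.Ioi (0:ℝ), ‖(c ^ k / Real.Gamma ((k:ℝ) * ν + 1)) *
          (x ^ ((k:ℝ) * ν) * Real.exp (-z * x))‖ = ∫ x in Set.Ioi (0:ℝ),
          (|c| ^ k / Real.Gamma ((k:ℝ) * ν + 1)) * (x ^ ((k:ℝ) * ν) * Real.exp (-z * x)) := by
        refine setIntegral_congr_fun measurableSet_Ioi fun x hx => ?_
        have hx : 0 < x := hx
        have h2 : 0 ≤ x ^ ((k:ℝ) * ν) * Real.exp (-z * x) := by positivity
        simp only [norm_mul, norm_div, Real.norm_eq_abs, abs_pow, abs_of_pos (hG k)]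
        rw [← abs_mul, abs_of_nonneg h2]
      have := (hG k).ne'
      rw [h1, integral_const_mul, hval]
      field_simp
      rw [← mul_pow, mul_one_div])
  have h3 : ∫ x in Set.Ioi (0:ℝ), Real.exp (-z * x) * ML ν (c * x ^ ν) =
      ∫ x in Set.Ioi (0:ℝ), ∑' k : ℕ, (c ^ k / Real.Gamma ((k:ℝ) * ν + 1)) *
      (x ^ ((k:ℝ) * ν) * Real.exp (-z * x)) := by
    refine setIntegral_congr_fun measurableSet_Ioi fun x hx => ?_
    have hx : 0 < x := hx
    simp only [ML]
    rw [← tsum_mul_left]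
    refine tsum_congr fun k => ?_
    rw [mul_comm (k:ℝ) ν, Real.rpow_mul_natCast hx.le, mul_pow]
    ring
  have hlt : |c / z ^ ν| < 1 := by
    rw [abs_div, abs_of_pos hzν]
    exact (div_lt_one hzν).2 hc
  have h4 : ∀ k : ℕ, ∫ x in Set.Ioi (0:ℝ), (c ^ k / Real.Gamma ((k:ℝ) * ν + 1)) *
      (x ^ ((k:ℝ) * ν) * Real.exp (-z * x)) = z⁻¹ * (c / z ^ ν) ^ k := by
    intro k
    have := (hG k).ne'
    rw [integral_const_mul, hval]
    field_simp
    rw [← mul_pow, mul_one_div]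
  have h5 : z ^ ν - c ≠ 0 := by
    have := le_abs_self c
    intro h
    linarith
  rw [h3, ← key, tsum_congr h4, tsum_mul_left, tsum_geometric_of_abs_lt_one hlt,
    Real.rpow_sub_one hz.ne']
  have h6 : 1 - c / z ^ ν = (z ^ ν - c) / z ^ ν := by field_simp
  rw [h6, inv_div]
  field_simp
end

section
/- Let 0<ν≤1, α>0, λ>0 with kλ≠α for every positive integer k, let n≥1 be an integer, and let z>0 satisfy z^ν>nλ and z^ν>α. Then the Laplace transform of the n-th state probability of the TFLBPwI satisfies ∫_0^∞ e^{−zt} p̄(n,t) dt = ∑_{k=1}^{n} C(n−1,k−1) ((−1)^k α/(kλ−α)) ( z^{ν−1}/(z^ν+kλ) − z^{ν−1}/(z^ν+α) ). Moreover ∫_0^∞ e^{−zt} p̄(0,t) dt = z^{ν−1}/(z^ν+α). -/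
open MeasureTheory

/-- The state probabilities `p̄(n,t)` of the time-fractional linear birth process
with immigration (TFLBPwI). -/
noncomputable def pbar (ν α lam : ℝ) (n : ℕ) (t : ℝ) : ℝ :=
  if n = 0 then ML ν (-α * t ^ ν)
  else ∑ k ∈ Finset.Icc 1 n,
    ((n - 1).choose (k - 1) : ℝ) * (-1 : ℝ) ^ k * (α / ((k : ℝ) * lam - α)) *
      (ML ν (-((k : ℝ) * lam) * t ^ ν) - ML ν (-α * t ^ ν))

lemma ML_laplace (ν c z : ℝ) (hν0 : 0 < ν) (hc : 0 < c) (hz : 0 < z) (hcz : c < z ^ ν) :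
    IntegrableOn (fun t => Real.exp (-z * t) * ML ν (-c * t ^ ν)) (Set.Ioi 0) ∧
    ∫ t in Set.Ioi (0:ℝ), Real.exp (-z * t) * ML ν (-c * t ^ ν) = z ^ (ν - 1) / (z ^ ν + c) := by
  have hzν : 0 < z ^ ν := Real.rpow_pos_of_pos hz ν
  have key : ∀ d : ℝ, ∀ k : ℕ,
      Set.EqOn (fun t : ℝ => Real.exp (-z * t) * ((d * t ^ ν) ^ k / Real.Gamma ((k : ℝ) * ν + 1)))
        (fun t => (d ^ k / Real.Gamma ((k : ℝ) * ν + 1)) *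
          (t ^ (((k : ℝ) * ν + 1) - 1) * Real.exp (-(z * t)))) (Set.Ioi 0) := by
    intro d k t ht
    have ht : 0 < t := ht
    have : (t ^ ν) ^ k = t ^ (((k : ℝ) * ν + 1) - 1) := by
      rw [← Real.rpow_natCast, ← Real.rpow_mul ht.le]; congr 1; ring
    simp only [mul_pow, this, neg_mul]
    ring
  have hG : ∀ k : ℕ, 0 < (k : ℝ) * ν + 1 := fun k => by positivity
  have hint : ∀ d : ℝ, ∀ k : ℕ, ∫ t in Set.Ioi (0:ℝ),
      Real.exp (-z * t) * ((d * t ^ ν) ^ k / Real.Gamma ((k : ℝ) * ν + 1)) =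
      z⁻¹ * (d / z ^ ν) ^ k := by
    intro d k
    rw [setIntegral_congr_fun measurableSet_Ioi (key d k), integral_const_mul,
      Real.integral_rpow_mul_exp_neg_mul_Ioi (hG k) hz]
    have h1 := (Real.Gamma_pos_of_pos (hG k)).ne'
    rw [one_div, Real.inv_rpow hz.le, Real.rpow_add hz, Real.rpow_one, mul_comm (k : ℝ) ν,
      Real.rpow_mul hz.le, Real.rpow_natCast, div_pow] at *
    field_simp
  have hI : ∀ k : ℕ, IntegrableOn (fun t : ℝ =>
      Real.exp (-z * t) * ((-c * t ^ ν) ^ k / Real.Gamma ((k : ℝ) * ν + 1))) (Set.Ioi 0) := by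
    intro k
    rw [integrableOn_congr_fun (key (-c) k) measurableSet_Ioi]
    refine Integrable.const_mul ?_ _
    have := integrableOn_rpow_mul_exp_neg_mul_rpow (s := (k : ℝ) * ν + 1 - 1) (p := 1) (b := z)
      (by linarith [hG k]) one_pos hz
    simpa [IntegrableOn] using this
  have hnorm : ∀ k : ℕ, ∫ t in Set.Ioi (0:ℝ),
      ‖Real.exp (-z * t) * ((-c * t ^ ν) ^ k / Real.Gamma ((k : ℝ) * ν + 1))‖ =
      z⁻¹ * (c / z ^ ν) ^ k := by
    intro k
    rw [← hint c k]
    refine setIntegral_congr_fun measurableSet_Ioi fun t ht => ?_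
    have ht : 0 < t := ht
    have h2 : 0 < t ^ ν := Real.rpow_pos_of_pos ht ν
    simp only [norm_mul, norm_div, norm_pow, Real.norm_eq_abs, abs_neg, abs_of_pos hc,
      abs_of_pos h2, Real.abs_exp, abs_of_pos (Real.Gamma_pos_of_pos (hG k))]
  have hs := hasSum_integral_of_summable_integral_norm hI (by
    simp only [hnorm]
    refine (summable_geometric_of_lt_one (by positivity) ?_).mul_left _
    rwa [div_lt_one hzν])
  have hML : ∀ t : ℝ, ∑' k : ℕ, Real.exp (-z * t) *
      ((-c * t ^ ν) ^ k / Real.Gamma ((k : ℝ) * ν + 1)) = Real.exp (-z * t) * ML ν (-c * t ^ ν) := by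
    intro t
    rw [tsum_mul_left, ML]
  simp only [hint, hML] at hs
  have hg : HasSum (fun k : ℕ => z⁻¹ * (-c / z ^ ν) ^ k) (z⁻¹ * (1 - (-c / z ^ ν))⁻¹) := by
    have hlt : ‖-c / z ^ ν‖ < 1 := by
      rw [norm_div, norm_neg, Real.norm_of_nonneg hc.le, Real.norm_of_nonneg hzν.le,
        div_lt_one hzν]
      exact hcz
    exact HasSum.mul_left z⁻¹ (hasSum_geometric_of_norm_lt_one hlt)
  have hval : ∫ t in Set.Ioi (0:ℝ), Real.exp (-z * t) * ML ν (-c * t ^ ν) =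
      z ^ (ν - 1) / (z ^ ν + c) := by
    refine (hs.unique hg).trans ?_
    rw [Real.rpow_sub hz, Real.rpow_one]
    have h3 : 1 - (-c / z ^ ν) = (z ^ ν + c) / z ^ ν := by field_simp; ring
    rw [h3, inv_div]
    field_simp
  refine ⟨?_, hval⟩
  by_contra hni
  have := integral_undef hni
  rw [hval] at this
  have h4 : 0 < z ^ (ν - 1) / (z ^ ν + c) := by positivity
  exact h4.ne' this

/-- Laplace transforms of the state probabilities of the TFLBPwI. -/
theorem laplace_pbar (ν α lam : ℝ) (hν0 : 0 < ν) (hν1 : ν ≤ 1) (hα : 0 < α) (hlam : 0 < lam)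
    (hne : ∀ k : ℕ, 1 ≤ k → (k : ℝ) * lam ≠ α) (n : ℕ) (hn : 1 ≤ n)
    (z : ℝ) (hz : 0 < z) (hz1 : (n : ℝ) * lam < z ^ ν) (hz2 : α < z ^ ν) :
    (∫ t in Set.Ioi (0:ℝ), Real.exp (-z * t) * pbar ν α lam n t =
      ∑ k ∈ Finset.Icc 1 n,
        ((n - 1).choose (k - 1) : ℝ) * ((-1 : ℝ) ^ k * α / ((k : ℝ) * lam - α)) *
          (z ^ (ν - 1) / (z ^ ν + (k : ℝ) * lam) - z ^ (ν - 1) / (z ^ ν + α))) ∧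
    (∫ t in Set.Ioi (0:ℝ), Real.exp (-z * t) * pbar ν α lam 0 t =
      z ^ (ν - 1) / (z ^ ν + α)) := by
  have hA := ML_laplace ν α z hν0 hα hz hz2
  refine ⟨?_, by simpa [pbar] using hA.2⟩
  have hK : ∀ k ∈ Finset.Icc 1 n, _ := fun k hk =>
    ML_laplace ν ((k : ℝ) * lam) z hν0
      (mul_pos (Nat.cast_pos.2 (Finset.mem_Icc.1 hk).1) hlam) hz
      (lt_of_le_of_lt (mul_le_mul_of_nonneg_right
        (Nat.cast_le.2 (Finset.mem_Icc.1 hk).2) hlam.le) hz1)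
  have hn0 : n ≠ 0 := by omega
  have e : ∀ t : ℝ, Real.exp (-z * t) * pbar ν α lam n t = ∑ k ∈ Finset.Icc 1 n,
      ((n - 1).choose (k - 1) : ℝ) * ((-1 : ℝ) ^ k * α / ((k : ℝ) * lam - α)) *
      (Real.exp (-z * t) * ML ν (-((k : ℝ) * lam) * t ^ ν)
        - Real.exp (-z * t) * ML ν (-α * t ^ ν)) := by
    intro t
    rw [pbar, if_neg hn0, Finset.mul_sum]
    refine Finset.sum_congr rfl fun k _ => ?_
    ring
  simp only [e]
  rw [integral_finsetSum]
  swap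
  · intro k hk
    exact ((hK k hk).1.sub hA.1).const_mul _
  refine Finset.sum_congr rfl fun k hk => ?_
  rw [integral_const_mul, integral_sub (hK k hk).1 hA.1, (hK k hk).2, hA.2]
end

section
/- Let 0<ν≤1, α>0, λ>0 with kλ≠α for every positive integer k. Then for every t≥0 the state probabilities of the TFLBPwI satisfy the regularity condition ∑_{n=0}^{∞} p̄(n,t) = 1, the series being convergent. -/
open MeasureTheory

/-- rising products `∏ (1 + s/i)` -/
noncomputable def aseq (n : ℕ) (s : ℝ) : ℝ := ∏ i ∈ Finset.range n, (1 + s / (i + 1))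

lemma choose_step (j m : ℕ) : (j : ℝ) * ((j + m).choose m : ℝ)
    = (m + 1) * (((j + (m + 1)).choose (m + 1) : ℝ) - ((j + m).choose m : ℝ)) := by
  have h := Nat.add_one_mul_choose_eq (j + m) m
  have h' : ((j + m + 1 : ℕ) : ℝ) * ((j + m).choose m : ℝ) = ((j + m + 1).choose (m + 1) : ℝ) * ((m + 1 : ℕ) : ℝ) := by
    exact_mod_cast h
  push_cast at h'
  rw [← add_assoc]
  linarith

lemma exists_coeff (ν : ℝ) (h0 : 0 < ν) (h1 : ν ≤ 1) (n : ℕ) :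
    ∃ c : ℕ → ℝ, (∀ m, 0 ≤ c m) ∧ ∀ j : ℕ,
      aseq n (ν * j) = ∑ m ∈ Finset.range (n + 1), c m * ((j + m).choose m : ℝ) := by
  induction n with
  | zero =>
    refine ⟨fun _ => 1, fun _ => zero_le_one, fun j => by simp [aseq]⟩
  | succ n ih =>
    obtain ⟨c, hc, h⟩ := ih
    let d : ℕ → ℝ := fun m => if m ≤ n then c m * (1 - ν * (m + 1) / (n + 1)) else 0
    let e : ℕ → ℝ := fun m => if m = 0 then 0 else c (m - 1) * (ν * m / (n + 1))
    refine ⟨fun m => d m + e m, fun m => add_nonneg ?_ ?_, fun j => ?_⟩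
    · simp only [d]
      split_ifs with hm
      · refine mul_nonneg (hc m) ?_
        have : (m : ℝ) ≤ n := by exact_mod_cast hm
        rw [sub_nonneg, div_le_one (by positivity)]
        nlinarith
      · exact le_rfl
    · simp only [e]
      split_ifs with hm
      · exact le_rfl
      · have := hc (m - 1)
        positivity
    · have : aseq (n + 1) (ν * j) = aseq n (ν * j) * (1 + ν * j / (n + 1)) := by
        simp [aseq, Finset.prod_range_succ]
      rw [this, h]
      simp only [add_mul, Finset.sum_add_distrib]
      rw [Finset.sum_range_succ (fun m => d m * _), Finset.sum_range_succ' (fun m => e m * _)]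
      have hd : d (n + 1) = 0 := by simp [d]
      have he : e 0 = 0 := by simp [e]
      rw [hd, he, zero_mul, zero_mul, add_zero, add_zero, ← Finset.sum_add_distrib, Finset.sum_mul]
      refine Finset.sum_congr rfl fun m hm => ?_
      have hm' : m ≤ n := by simpa [Nat.lt_succ_iff] using hm
      have := choose_step j m
      simp only [d, e, hm', if_true, Nat.succ_ne_zero, if_false, Nat.add_sub_cancel, Nat.cast_add, Nat.cast_one]
      have hn : (n : ℝ) + 1 ≠ 0 := by positivity
      field_simp
      linear_combination (c m * ν) * this

lemma aseq_pos (n : ℕ) (s : ℝ) (hs : 0 ≤ s) : 0 < aseq n s :=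
  Finset.prod_pos fun i _ => by positivity

lemma aseq_anti_step (n : ℕ) (hn : 1 ≤ n) (s : ℝ) (hs : 0 ≤ s) :
    aseq (n + 1) s * ((n + 1 : ℕ) : ℝ) ^ (-s) ≤ aseq n s * (n : ℝ) ^ (-s) := by
  have hn' : (0 : ℝ) < n := by exact_mod_cast hn
  have e1 : aseq (n + 1) s = aseq n s * (1 + s / (n + 1)) := by
    simp [aseq, Finset.prod_range_succ]
  rw [e1, mul_assoc]
  refine mul_le_mul_of_nonneg_left ?_ (aseq_pos n s hs).le
  push_cast
  rw [Real.rpow_neg (by positivity), Real.rpow_neg (by positivity)]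
  rw [← div_eq_mul_inv, div_le_iff₀ (by positivity), inv_mul_eq_div,
    ← Real.div_rpow (by positivity) (by positivity)]
  have h1 : Real.exp (1 / (n + 1)) ≤ (n + 1) / n := by
    have := Real.one_sub_le_exp_neg (1 / ((n : ℝ) + 1))
    rw [Real.exp_neg] at this
    have h2 : 1 - 1 / ((n : ℝ) + 1) = n / (n + 1) := by field_simp; ring
    rw [h2] at this
    have := inv_anti₀ (by positivity) this
    rwa [inv_inv, inv_div] at this
  calc 1 + s / (n + 1) ≤ Real.exp (s / (n + 1)) := by
        have := Real.add_one_le_exp (s / ((n : ℝ) + 1)); linarith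
    _ = Real.exp (1 / (n + 1)) ^ s := by rw [← Real.exp_mul]; congr 1; ring
    _ ≤ _ := Real.rpow_le_rpow (Real.exp_pos _).le h1 hs

lemma aseq_anti (n0 n : ℕ) (hn0 : 1 ≤ n0) (h : n0 ≤ n) (s : ℝ) (hs : 0 ≤ s) :
    aseq n s * (n : ℝ) ^ (-s) ≤ aseq n0 s * (n0 : ℝ) ^ (-s) := by
  induction n, h using Nat.le_induction with
  | base => exact le_rfl
  | succ n hn ih => exact (aseq_anti_step n (hn0.trans hn) s hs).trans ih

lemma aseq_tendsto (s : ℝ) (hs : 0 ≤ s) :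
    Filter.Tendsto (fun n : ℕ => aseq n s * (n : ℝ) ^ (-s)) Filter.atTop
      (nhds (1 / Real.Gamma (s + 1))) := by
  rcases hs.eq_or_lt with rfl | hs
  · simp [aseq]
  · have h := ((Real.GammaSeq_tendsto_Gamma s).const_mul s).inv₀
      (mul_ne_zero hs.ne' (Real.Gamma_pos_of_pos hs).ne')
    rw [Real.Gamma_add_one hs.ne', one_div]
    refine h.congr' ?_
    filter_upwards [Filter.eventually_ge_atTop 1] with n hn
    have hn' : (0 : ℝ) < n := by exact_mod_cast hn
    have key : aseq n s * (n.factorial : ℝ) = ∏ j ∈ Finset.range n, (s + ((j + 1 : ℕ) : ℝ)) := by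
      rw [← Finset.prod_range_add_one_eq_factorial, aseq, Nat.cast_prod, ← Finset.prod_mul_distrib]
      refine Finset.prod_congr rfl fun i _ => ?_
      push_cast
      field_simp
      ring
    rw [Real.GammaSeq, Finset.prod_range_succ', ← key, Real.rpow_neg hn'.le]
    have := (aseq_pos n s hs.le).ne'
    have := (Real.rpow_pos_of_pos hn' s).ne'
    have : (n.factorial : ℝ) ≠ 0 := by positivity
    simp only [Nat.cast_zero, add_zero]
    field_simp

/-- approximants -/
lemma aseq_hasSum (ν : ℝ) (n : ℕ) (c : ℕ → ℝ)
    (h : ∀ j : ℕ, aseq n (ν * j) = ∑ m ∈ Finset.range (n + 1), c m * ((j + m).choose m : ℝ))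
    (r : ℝ) (hr : |r| < 1) :
    HasSum (fun j : ℕ => r ^ j * aseq n (ν * j))
      (∑ m ∈ Finset.range (n + 1), c m * (1 / (1 - r) ^ (m + 1))) := by
  have : (fun j : ℕ => r ^ j * aseq n (ν * j)) =
      fun j : ℕ => ∑ m ∈ Finset.range (n + 1), c m * (((j + m).choose m : ℝ) * r ^ j) := by
    funext j
    rw [h, Finset.mul_sum]
    exact Finset.sum_congr rfl fun m _ => by ring
  rw [this]
  refine hasSum_sum fun m _ => ?_
  have := hasSum_choose_mul_geometric_of_norm_lt_one (𝕜 := ℝ) m (r := r) hr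
  exact this.mul_left (c m)

lemma exists_n0 (ν : ℝ) (h0 : 0 < ν) (X : ℝ) :
    ∃ n0 : ℕ, 1 ≤ n0 ∧ ∀ n, n0 ≤ n → |X * (n : ℝ) ^ (-ν)| < 1 := by
  have h : Filter.Tendsto (fun n : ℕ => |X * (n : ℝ) ^ (-ν)|) Filter.atTop (nhds 0) := by
    have := (((tendsto_rpow_neg_atTop h0).comp tendsto_natCast_atTop_atTop).const_mul X).abs
    simpa using this
  obtain ⟨N, hN⟩ := Filter.eventually_atTop.1 (h.eventually (gt_mem_nhds zero_lt_one))
  exact ⟨max 1 N, le_max_left _ _, fun n hn => hN n ((le_max_right _ _).trans hn)⟩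

lemma term_eq (ν X : ℝ) (n : ℕ) (hn : 1 ≤ n) (j : ℕ) :
    (X * (n : ℝ) ^ (-ν)) ^ j * aseq n (ν * j) = X ^ j * (aseq n (ν * j) * (n : ℝ) ^ (-(ν * j))) := by
  rw [mul_pow, ← Real.rpow_natCast ((n : ℝ) ^ (-ν)) j, ← Real.rpow_mul (by positivity), neg_mul]
  ring

lemma exists_bound (ν : ℝ) (h0 : 0 < ν) (h1 : ν ≤ 1) (X : ℝ) :
    ∃ (n0 : ℕ) (b : ℕ → ℝ), Summable b ∧ 1 ≤ n0 ∧ (∀ n, n0 ≤ n → |X * (n : ℝ) ^ (-ν)| < 1) ∧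
      ∀ n, n0 ≤ n → ∀ j : ℕ, ‖(X * (n : ℝ) ^ (-ν)) ^ j * aseq n (ν * j)‖ ≤ b j := by
  obtain ⟨n0, hn0, hlt⟩ := exists_n0 ν h0 X
  obtain ⟨c, hc, h⟩ := exists_coeff ν h0 h1 n0
  refine ⟨n0, _, Summable.norm (aseq_hasSum ν n0 c h (X * (n0 : ℝ) ^ (-ν)) (hlt n0 le_rfl)).summable,
    hn0, hlt, fun n hn j => ?_⟩
  rw [term_eq _ _ _ hn0, term_eq _ _ _ (hn0.trans hn), norm_mul (X ^ j), norm_mul (X ^ j)]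
  have hs : 0 ≤ ν * j := by positivity
  have p1 := aseq_pos n _ hs
  have p2 := aseq_pos n0 _ hs
  refine mul_le_mul_of_nonneg_left ?_ (norm_nonneg (X ^ j))
  rw [Real.norm_of_nonneg (by positivity), Real.norm_of_nonneg (by positivity)]
  exact aseq_anti n0 n hn0 hn _ hs

lemma term_tendsto (ν : ℝ) (h0 : 0 < ν) (X : ℝ) (j : ℕ) :
    Filter.Tendsto (fun n : ℕ => (X * (n : ℝ) ^ (-ν)) ^ j * aseq n (ν * j)) Filter.atTop
      (nhds (X ^ j / Real.Gamma (j * ν + 1))) := by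
  have := (aseq_tendsto (ν * j) (by positivity)).const_mul (X ^ j)
  rw [mul_one_div, mul_comm ν] at this
  refine this.congr' ?_
  filter_upwards [Filter.eventually_ge_atTop 1] with n hn
  rw [mul_comm _ ν, term_eq _ _ _ hn]

lemma ML_summable (ν : ℝ) (h0 : 0 < ν) (h1 : ν ≤ 1) (X : ℝ) :
    Summable fun j : ℕ => X ^ j / Real.Gamma (j * ν + 1) := by
  obtain ⟨n0, b, hb, hn0, hlt, hle⟩ := exists_bound ν h0 h1 X
  refine Summable.of_norm_bounded hb fun j => ?_
  refine le_of_tendsto (term_tendsto ν h0 X j).norm ?_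
  filter_upwards [Filter.eventually_ge_atTop n0] with n hn using hle n hn j

lemma ML_zero (ν : ℝ) : ML ν 0 = 1 := by
  rw [ML, tsum_eq_single 0]
  · simp
  · intro j hj; simp [hj]

lemma ML_cont (ν : ℝ) (h0 : 0 < ν) (h1 : ν ≤ 1) : ContinuousAt (ML ν) 0 := by
  have : ContinuousOn (ML ν) (Set.Icc (-1) 1) := by
    unfold ML
    refine continuousOn_tsum (u := fun j : ℕ => (1 : ℝ) ^ j / Real.Gamma (j * ν + 1))
      (fun j => by fun_prop) (ML_summable ν h0 h1 1) ?_
    intro j x hx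
    have hg : 0 < Real.Gamma (j * ν + 1) := Real.Gamma_pos_of_pos (by positivity)
    rw [norm_div, norm_pow, Real.norm_of_nonneg hg.le]
    gcongr
    exact abs_le.2 hx
  exact this.continuousAt (Icc_mem_nhds (by norm_num) (by norm_num))

lemma approx (ν : ℝ) (h0 : 0 < ν) (h1 : ν ≤ 1) (c : ℕ → ℕ → ℝ)
    (h : ∀ n, ∀ j : ℕ, aseq n (ν * j) = ∑ m ∈ Finset.range (n + 1), c n m * ((j + m).choose m : ℝ))
    (X : ℝ) :
    Filter.Tendsto (fun n : ℕ => ∑ m ∈ Finset.range (n + 1),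
      c n m * (1 / (1 - X * (n : ℝ) ^ (-ν)) ^ (m + 1))) Filter.atTop (nhds (ML ν X)) := by
  obtain ⟨n0, b, hb, hn0, hlt, hle⟩ := exists_bound ν h0 h1 X
  have := tendsto_tsum_of_dominated_convergence hb (term_tendsto ν h0 X) 
    (Filter.eventually_atTop.2 ⟨n0, hle⟩)
  refine Filter.Tendsto.congr' ?_ this
  filter_upwards [Filter.eventually_ge_atTop n0] with n hn
  exact (aseq_hasSum ν n (c n) (h n) _ (hlt n hn)).tsum_eq

/-- finite linear combinations of evaluations at nonnegative points -/
inductive Good : ((ℝ → ℝ) → ℝ) → Prop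
  | eval (x : ℝ) (hx : 0 ≤ x) : Good (fun F => F x)
  | add (A B : (ℝ → ℝ) → ℝ) (hA : Good A) (hB : Good B) : Good (fun F => A F + B F)
  | smul (a : ℝ) (A : (ℝ → ℝ) → ℝ) (hA : Good A) : Good (fun F => a * A F)

lemma Good.sub {A B : (ℝ → ℝ) → ℝ} (hA : Good A) (hB : Good B) : Good (fun F => A F - B F) := by
  have := Good.add _ _ hA (Good.smul (-1) _ hB)
  simpa [sub_eq_add_neg] using this

lemma Good.sum {ι : Type} (s : Finset ι) (A : ι → (ℝ → ℝ) → ℝ) (h : ∀ i ∈ s, Good (A i)) :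
    Good (fun F => ∑ i ∈ s, A i F) := by
  classical
  induction s using Finset.induction_on with
  | empty =>
    have := Good.smul 0 _ (Good.eval 0 le_rfl)
    simpa using this
  | insert i s hi ih =>
    simp only [Finset.sum_insert hi]
    exact Good.add _ _ (h i (by simp)) (ih fun j hj => h j (by simp [hj]))

lemma Good.lin {A : (ℝ → ℝ) → ℝ} (hA : Good A) {ι : Type} (s : Finset ι) (c : ι → ℝ)
    (F : ι → ℝ → ℝ) : A (fun x => ∑ i ∈ s, c i * F i x) = ∑ i ∈ s, c i * A (F i) := by
  induction hA with
  | eval x hx => rfl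
  | add A B _ _ ihA ihB => simp only [ihA, ihB, mul_add, Finset.sum_add_distrib]
  | smul a A _ ih =>
    simp only [ih, Finset.mul_sum]
    exact Finset.sum_congr rfl fun i _ => by ring

lemma Good.tendsto {A : (ℝ → ℝ) → ℝ} (hA : Good A) (F : ℕ → ℝ → ℝ) (f : ℝ → ℝ)
    (h : ∀ x, 0 ≤ x → Filter.Tendsto (fun n => F n x) Filter.atTop (nhds (f x))) :
    Filter.Tendsto (fun n => A (F n)) Filter.atTop (nhds (A f)) := by
  induction hA with
  | eval x hx => exact h x hx
  | add A B _ _ ihA ihB => exact ihA.add ihB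
  | smul a A _ ih => exact ih.const_mul a

lemma gamma_int (m : ℕ) (r : ℝ) (hr : 0 < r) :
    IntegrableOn (fun s : ℝ => s ^ m * Real.exp (-(r * s))) (Set.Ioi 0) ∧
    ∫ s in Set.Ioi (0 : ℝ), s ^ m * Real.exp (-(r * s)) = m.factorial * (1 / r ^ (m + 1)) := by
  have h := Real.integral_rpow_mul_exp_neg_mul_Ioi (a := (m : ℝ) + 1) (r := r) (by positivity) hr
  have e : ∫ s in Set.Ioi (0 : ℝ), s ^ m * Real.exp (-(r * s)) = m.factorial * (1 / r ^ (m + 1)) := by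
    rw [Real.Gamma_nat_eq_factorial] at h
    simp only [add_sub_cancel_right, Real.rpow_natCast] at h
    rw [h]
    have : (m : ℝ) + 1 = ((m + 1 : ℕ) : ℝ) := by push_cast; rfl
    rw [this, Real.rpow_natCast, one_div_pow, mul_comm]
  refine ⟨?_, e⟩
  by_contra hcon
  rw [integral_undef hcon] at e
  have : 0 < (m.factorial : ℝ) * (1 / r ^ (m + 1)) := by positivity
  linarith

lemma Good.gamma {A : (ℝ → ℝ) → ℝ} (hA : Good A) (m : ℕ) (κ : ℝ) (hκ : 0 ≤ κ) :
    IntegrableOn (fun s : ℝ => s ^ m * Real.exp (-s) * A (fun x => Real.exp (-x * (κ * s)))) (Set.Ioi 0) ∧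
    ∫ s in Set.Ioi (0 : ℝ), s ^ m * Real.exp (-s) * A (fun x => Real.exp (-x * (κ * s)))
      = m.factorial * A (fun x => 1 / (1 + x * κ) ^ (m + 1)) := by
  induction hA with
  | eval x hx =>
    have := gamma_int m (1 + x * κ) (by positivity)
    have e : (fun s : ℝ => s ^ m * Real.exp (-s) * Real.exp (-x * (κ * s)))
        = fun s : ℝ => s ^ m * Real.exp (-((1 + x * κ) * s)) := by
      funext s
      rw [mul_assoc, ← Real.exp_add]
      congr 2
      ring
    rw [e]
    exact this
  | add A B _ _ ihA ihB =>
    simp only [mul_add]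
    refine ⟨ihA.1.add ihB.1, ?_⟩
    rw [integral_add ihA.1 ihB.1, ihA.2, ihB.2]
  | smul a A _ ih =>
    simp only [mul_left_comm _ a]
    refine ⟨ih.1.const_mul a, ?_⟩
    rw [integral_const_mul, ih.2]

lemma Good.pos_rat {A : (ℝ → ℝ) → ℝ} (hA : Good A)
    (hp : ∀ s, 0 ≤ s → 0 ≤ A (fun x => Real.exp (-x * s))) (m : ℕ) (κ : ℝ) (hκ : 0 ≤ κ) :
    0 ≤ A (fun x => 1 / (1 + x * κ) ^ (m + 1)) := by
  have h := (hA.gamma m κ hκ).2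
  have h2 : 0 ≤ ∫ s in Set.Ioi (0 : ℝ),
      s ^ m * Real.exp (-s) * A (fun x => Real.exp (-x * (κ * s))) := by
    refine setIntegral_nonneg measurableSet_Ioi fun s hs => ?_
    have hs' : (0 : ℝ) < s := hs
    exact mul_nonneg (by positivity) (hp _ (by positivity))
  rw [h] at h2
  exact nonneg_of_mul_nonneg_right h2 (by positivity)

lemma Good.pos_ML {A : (ℝ → ℝ) → ℝ} (hA : Good A)
    (hp : ∀ s, 0 ≤ s → 0 ≤ A (fun x => Real.exp (-x * s)))
    (ν : ℝ) (h0 : 0 < ν) (h1 : ν ≤ 1) (τ : ℝ) (hτ : 0 ≤ τ) :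
    0 ≤ A (fun x => ML ν (-x * τ)) := by
  choose c hc h using exists_coeff ν h0 h1
  have ht := hA.tendsto (fun n x => ∑ m ∈ Finset.range (n + 1),
      c n m * (1 / (1 + x * (τ * (n : ℝ) ^ (-ν))) ^ (m + 1))) (fun x => ML ν (-x * τ)) (by
    intro x _
    have := approx ν h0 h1 c h (-x * τ)
    refine this.congr fun n => ?_
    refine Finset.sum_congr rfl fun m _ => ?_
    congr 4
    ring)
  refine ge_of_tendsto' ht fun n => ?_
  rw [hA.lin (Finset.range (n + 1)) (c n)
    (fun m x => 1 / (1 + x * (τ * (n : ℝ) ^ (-ν))) ^ (m + 1))]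
  exact Finset.sum_nonneg fun m _ => mul_nonneg (hc n m) (hA.pos_rat hp m _ (by positivity))

/-- the functional underlying `pbar` -/
noncomputable def Q (α lam : ℝ) (n : ℕ) (F : ℝ → ℝ) : ℝ :=
  if n = 0 then F α
  else ∑ k ∈ Finset.Icc 1 n,
    ((n - 1).choose (k - 1) : ℝ) * (-1 : ℝ) ^ k * (α / ((k : ℝ) * lam - α)) *
      (F ((k : ℝ) * lam) - F α)

lemma Q_good (α lam : ℝ) (hα : 0 < α) (hlam : 0 < lam) (n : ℕ) : Good (Q α lam n) := by
  unfold Q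
  by_cases hn : n = 0
  · simp only [hn, if_true]
    exact Good.eval _ hα.le
  · simp only [hn, if_false]
    exact Good.sum _ _ fun k _ => Good.smul _ _
      (Good.sub (Good.eval _ (by positivity)) (Good.eval _ hα.le))

lemma exp_conv (α : ℝ) (x s : ℝ) (hx : x ≠ α) :
    ∫ u in (0 : ℝ)..s, α * Real.exp (-α * (s - u)) * Real.exp (-x * u)
      = -(α / (x - α)) * (Real.exp (-x * s) - Real.exp (-α * s)) := by
  have hx' : x - α ≠ 0 := sub_ne_zero.2 hx
  have hd : ∀ u ∈ Set.uIcc 0 s, HasDerivAt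
      (fun u : ℝ => -(α / (x - α)) * (Real.exp (-α * (s - u)) * Real.exp (-x * u)))
      (α * Real.exp (-α * (s - u)) * Real.exp (-x * u)) u := by
    intro u _
    have d1 : HasDerivAt (fun u : ℝ => Real.exp (-α * (s - u)))
        (Real.exp (-α * (s - u)) * (-α * (-1))) u :=
      (((hasDerivAt_id u).const_sub s).const_mul (-α)).exp
    have d2 : HasDerivAt (fun u : ℝ => Real.exp (-x * u)) (Real.exp (-x * u) * (-x * 1)) u :=
      ((hasDerivAt_id u).const_mul (-x)).exp
    refine ((d1.mul d2).const_mul (-(α / (x - α)))).congr_deriv ?_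
    field_simp
    ring
  rw [intervalIntegral.integral_eq_sub_of_hasDerivAt hd
    (Continuous.intervalIntegrable (by fun_prop) _ _)]
  simp
  ring

lemma Q_exp (α lam : ℝ) (hne : ∀ k : ℕ, 1 ≤ k → (k : ℝ) * lam ≠ α) (m : ℕ) (s : ℝ) :
    Q α lam (m + 1) (fun x => Real.exp (-x * s)) = ∫ u in (0 : ℝ)..s,
      α * Real.exp (-α * (s - u)) * (Real.exp (-lam * u) * (1 - Real.exp (-lam * u)) ^ m) := by
  have e : ∀ u : ℝ, α * Real.exp (-α * (s - u)) * (Real.exp (-lam * u) * (1 - Real.exp (-lam * u)) ^ m)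
      = ∑ i ∈ Finset.range (m + 1), ((m.choose i : ℝ) * (-1) ^ i) *
        (α * Real.exp (-α * (s - u)) * Real.exp (-(((i + 1 : ℕ) : ℝ) * lam) * u)) := by
    intro u
    rw [show 1 - Real.exp (-lam * u) = -Real.exp (-lam * u) + 1 by ring, add_pow,
      Finset.mul_sum, Finset.mul_sum]
    refine Finset.sum_congr rfl fun i _ => ?_
    have : Real.exp (-(((i + 1 : ℕ) : ℝ) * lam) * u)
        = Real.exp (-lam * u) * Real.exp (-lam * u) ^ i := by
      rw [← Real.exp_nat_mul, ← Real.exp_add]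
      congr 1
      push_cast
      ring
    rw [this, neg_pow]
    ring
  simp only [e]
  rw [intervalIntegral.integral_finsetSum
    (fun i _ => Continuous.intervalIntegrable (by fun_prop) _ _)]
  unfold Q
  rw [if_neg (Nat.succ_ne_zero m), ← Finset.Ico_add_one_right_eq_Icc, Finset.sum_Ico_eq_sum_range]
  refine Finset.sum_congr (by simp) fun i _ => ?_
  rw [intervalIntegral.integral_const_mul, exp_conv _ _ _ (hne (i + 1) (by omega))]
  rw [add_comm 1 i]
  simp only [Nat.add_sub_cancel, pow_succ]
  ring

lemma rem_exp (α lam : ℝ) (hα : 0 < α) (hne : ∀ k : ℕ, 1 ≤ k → (k : ℝ) * lam ≠ α) (N : ℕ) (s : ℝ) :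
    1 - ∑ n ∈ Finset.range (N + 1), Q α lam n (fun x => Real.exp (-x * s)) = ∫ u in (0 : ℝ)..s,
      α * Real.exp (-α * (s - u)) * (1 - Real.exp (-lam * u)) ^ N := by
  induction N with
  | zero =>
    have := exp_conv α 0 s hα.ne
    simp only [neg_zero, zero_mul, Real.exp_zero, mul_one, zero_sub] at this
    simp only [pow_zero, mul_one, this]
    simp [Q, div_neg, div_self hα.ne']
  | succ N ih =>
    rw [Finset.sum_range_succ, ← sub_sub, ih, Q_exp α lam hne,
      ← intervalIntegral.integral_sub (Continuous.intervalIntegrable (by fun_prop) _ _)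
        (Continuous.intervalIntegrable (by fun_prop) _ _)]
    congr 1
    funext u
    ring

lemma rem_le (α lam : ℝ) (hα : 0 < α) (N : ℕ) (s B : ℝ) (hs : 0 ≤ s) (hB : 0 ≤ B)
    (h : ∀ u ∈ Set.Icc 0 s, (1 - Real.exp (-lam * u)) ^ N ≤ B) :
    ∫ u in (0 : ℝ)..s, α * Real.exp (-α * (s - u)) * (1 - Real.exp (-lam * u)) ^ N ≤ B := by
  have h1 : ∫ u in (0 : ℝ)..s, α * Real.exp (-α * (s - u)) * (1 - Real.exp (-lam * u)) ^ N
      ≤ ∫ u in (0 : ℝ)..s, B * (α * Real.exp (-α * (s - u)) * Real.exp (-0 * u)) := by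
    refine intervalIntegral.integral_mono_on hs (Continuous.intervalIntegrable (by fun_prop) _ _)
        (Continuous.intervalIntegrable (by fun_prop) _ _) fun u hu => ?_
    have := h u hu
    simp only [neg_zero, zero_mul, Real.exp_zero, mul_one]
    rw [mul_comm]
    gcongr
  rw [intervalIntegral.integral_const_mul, exp_conv α 0 s hα.ne] at h1
  have e : -(α / (0 - α)) = 1 := by rw [zero_sub, div_neg, neg_neg, div_self hα.ne']
  rw [e] at h1
  simp only [neg_zero, zero_mul, Real.exp_zero, one_mul] at h1
  have := mul_nonneg hB (Real.exp_pos (-α * s)).le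
  linarith

/-- The state probabilities of the TFLBPwI satisfy the regularity condition
`∑_{n=0}^∞ p̄(n,t) = 1`. -/
theorem pbar_regularity (ν α lam : ℝ) (hν0 : 0 < ν) (hν1 : ν ≤ 1) (hα : 0 < α)
    (hlam : 0 < lam) (hne : ∀ k : ℕ, 1 ≤ k → (k : ℝ) * lam ≠ α) (t : ℝ) (ht : 0 ≤ t) :
    HasSum (fun n : ℕ => pbar ν α lam n t) 1 := by
  have hτ : 0 ≤ t ^ ν := Real.rpow_nonneg ht ν
  set f : ℝ → ℝ := fun x => ML ν (-x * t ^ ν) with hf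
  have f0 : f 0 = 1 := by simp [hf, ML_zero]
  have hfc : ContinuousAt f 0 := by
    have h1 : ContinuousAt (fun x : ℝ => -x * t ^ ν) 0 := by fun_prop
    exact ContinuousAt.comp (g := ML ν) (by simpa using ML_cont ν hν0 hν1) h1
  have hpQ : ∀ n, pbar ν α lam n t = Q α lam n f := fun n => rfl
  have hpos : ∀ (A : (ℝ → ℝ) → ℝ), Good A → (∀ s, 0 ≤ s → 0 ≤ A (fun x => Real.exp (-x * s))) →
      0 ≤ A f := fun A hA hp => hA.pos_ML hp ν hν0 hν1 _ hτ
  have hb : ∀ u : ℝ, 0 ≤ u → 0 ≤ 1 - Real.exp (-lam * u) := fun u hu => by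
    rw [sub_nonneg, Real.exp_le_one_iff]
    nlinarith
  have hQ0 : ∀ n, 0 ≤ Q α lam n f := by
    intro n
    refine hpos _ (Q_good α lam hα hlam n) fun s hs => ?_
    rcases n with _ | m
    · simp only [Q, if_true]; positivity
    · rw [Q_exp α lam hne]
      refine intervalIntegral.integral_nonneg hs fun u hu => ?_
      have := hb u hu.1
      positivity
  have hsumG : ∀ N, Good (fun F => ∑ n ∈ Finset.range (N + 1), Q α lam n F) := fun N =>
    Good.sum _ _ fun n _ => Q_good α lam hα hlam n
  have hremG : ∀ N, Good (fun F => F 0 - ∑ n ∈ Finset.range (N + 1), Q α lam n F) := fun N =>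
    Good.sub (Good.eval 0 le_rfl) (hsumG N)
  have hrem0 : ∀ N, 0 ≤ 1 - ∑ n ∈ Finset.range (N + 1), Q α lam n f := by
    intro N
    have := hpos _ (hremG N) (by
      intro s hs
      simp only [neg_zero, zero_mul, Real.exp_zero]
      rw [rem_exp α lam hα hne]
      refine intervalIntegral.integral_nonneg hs fun u hu => ?_
      have := hb u hu.1
      positivity)
    simpa [f0] using this
  have hrem1 : ∀ N (δ : ℝ), 0 < δ → 1 - ∑ n ∈ Finset.range (N + 1), Q α lam n f
      ≤ (1 - Real.exp (-lam * (1 / δ))) ^ N + 2 * (1 - f δ) := by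
    intro N δ hδ
    have hM := hb (1 / δ) (by positivity)
    have := hpos _ (((Good.eval 0 le_rfl).smul ((1 - Real.exp (-lam * (1 / δ))) ^ N)).add _ _
      (((Good.eval 0 le_rfl).sub (Good.eval δ hδ.le)).smul 2) |>.sub (hremG N)) (by
      intro s hs
      simp only [neg_zero, zero_mul, Real.exp_zero, mul_one]
      rw [rem_exp α lam hα hne, sub_nonneg]
      rcases le_total s (1 / δ) with h | h
      · have h1 := rem_le α lam hα N s ((1 - Real.exp (-lam * (1 / δ))) ^ N) hs (by positivity) (by
          intro u hu
          refine pow_le_pow_left₀ (hb u hu.1) ?_ N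
          have : Real.exp (-lam * (1 / δ)) ≤ Real.exp (-lam * u) := by
            rw [Real.exp_le_exp]
            nlinarith [hu.2]
          linarith)
        have h2 : Real.exp (-δ * s) ≤ 1 := by
          rw [Real.exp_le_one_iff]; nlinarith
        linarith
      · have h1 := rem_le α lam hα N s 1 hs zero_le_one (by
          intro u hu
          refine pow_le_one₀ (hb u hu.1) ?_
          have := Real.exp_pos (-lam * u)
          linarith)
        have h2 : Real.exp (-δ * s) ≤ 1 / 2 := by
          have h3 : 1 ≤ δ * s := by rwa [div_le_iff₀ hδ, mul_comm] at h
          calc Real.exp (-δ * s) ≤ Real.exp (-1) := by rw [Real.exp_le_exp]; linarith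
            _ ≤ 1 / 2 := by
              rw [Real.exp_neg, one_div]
              refine inv_anti₀ (by norm_num) ?_
              have := Real.add_one_le_exp (1 : ℝ)
              linarith
        have : 0 ≤ (1 - Real.exp (-lam * (1 / δ))) ^ N := by positivity
        linarith)
    simp only [f0, mul_one] at this
    linarith
  simp only [hpQ]
  rw [hasSum_iff_tendsto_nat_of_nonneg hQ0, ← Filter.tendsto_add_atTop_iff_nat 1]
  rw [Metric.tendsto_atTop]
  intro ε hε
  obtain ⟨δ, hδ, hfδ⟩ : ∃ δ : ℝ, 0 < δ ∧ 2 * (1 - f δ) < ε / 2 := by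
    obtain ⟨d, hd, h⟩ := Metric.continuousAt_iff.1 hfc (ε / 4) (by positivity)
    refine ⟨d / 2, by positivity, ?_⟩
    have := h (x := d / 2) (by rw [Real.dist_eq, sub_zero, abs_of_pos (by positivity)]; linarith)
    rw [f0, Real.dist_eq] at this
    linarith [(abs_lt.1 this).1]
  have hlt : 1 - Real.exp (-lam * (1 / δ)) < 1 := by
    have := Real.exp_pos (-lam * (1 / δ)); linarith
  obtain ⟨N0, hN0⟩ := exists_pow_lt_of_lt_one (show 0 < ε / 2 by positivity) hlt
  refine ⟨N0, fun N hN => ?_⟩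
  have h1 := hrem0 N
  have h2 := hrem1 N δ hδ
  have h3 := pow_le_pow_of_le_one (hb (1 / δ) (by positivity)) hlt.le hN
  rw [Real.dist_eq, abs_sub_comm, abs_of_nonneg h1]
  linarith
end

section
/- Let 0<ν≤1, α>0, λ>0 with kλ≠α for every positive integer k. Then for every t≥0, the mean of the TFLBPwI satisfies ∑_{n=1}^{∞} n p̄(n,t) = (α/(α+λ)) ( E_ν(λ t^ν) − E_ν(−α t^ν) ), the series being convergent. -/
open MeasureTheory

noncomputable def Lf (ν : ℝ) : ℕ → (ℕ → ℝ) → ℝ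
  | 0, f => f 0
  | n + 1, f => Lf ν n (fun k => (1 - ν * (k + 1) / (n + 1)) * f k + ν * (k + 1) / (n + 1) * f (k + 1))

lemma Lf_mono (ν : ℝ) (h0 : 0 < ν) (h1 : ν ≤ 1) (n : ℕ) : ∀ f g : ℕ → ℝ, (∀ k, f k ≤ g k) →
    Lf ν n f ≤ Lf ν n g := by
  have key : ∀ f g : ℕ → ℝ, (∀ k ≤ n, f k ≤ g k) → Lf ν n f ≤ Lf ν n g := by
    induction n with
    | zero => intro f g h; exact h 0 le_rfl
    | succ n ih =>
      intro f g h
      apply ih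
      intro k hk
      have hk' : (k : ℝ) ≤ n := by exact_mod_cast hk
      have a1 : 0 ≤ ν * (k + 1) / ((n : ℝ) + 1) := by positivity
      have a2 : 0 ≤ 1 - ν * (k + 1) / ((n : ℝ) + 1) := by
        rw [sub_nonneg, div_le_one (by positivity)]
        nlinarith [(Nat.cast_nonneg k : (0 : ℝ) ≤ k)]
      have b1 := h k (by omega)
      have b2 := h (k + 1) (by omega)
      gcongr
  intro f g h
  exact key f g (fun k _ => h k)

lemma Lf_mul (ν c : ℝ) (n : ℕ) : ∀ f : ℕ → ℝ, Lf ν n (fun k => c * f k) = c * Lf ν n f := by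
  induction n with
  | zero => intro f; rfl
  | succ n ih =>
    intro f
    simp only [Lf]
    rw [← ih]
    congr 1; ext k; ring

lemma Lf_add (ν : ℝ) (n : ℕ) : ∀ f g : ℕ → ℝ,
    Lf ν n (fun k => f k + g k) = Lf ν n f + Lf ν n g := by
  induction n with
  | zero => intro f g; rfl
  | succ n ih =>
    intro f g
    simp only [Lf]
    rw [← ih]
    congr 1; ext k; ring

lemma Lf_sub (ν : ℝ) (n : ℕ) (f g : ℕ → ℝ) :
    Lf ν n (fun k => f k - g k) = Lf ν n f - Lf ν n g := by
  have := Lf_add ν n f (fun k => (-1) * g k)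
  rw [Lf_mul] at this
  rw [sub_eq_add_neg, ← neg_one_mul, ← this]
  congr 1; ext k; ring

lemma Lf_zero (ν : ℝ) (n : ℕ) : Lf ν n (fun _ => 0) = 0 := by
  have := Lf_mul ν 0 n (fun _ => 0)
  simpa using this

lemma Lf_sum (ν : ℝ) (n : ℕ) {ι : Type} (s : Finset ι) (F : ι → ℕ → ℝ) :
    Lf ν n (fun k => ∑ i ∈ s, F i k) = ∑ i ∈ s, Lf ν n (F i) := by
  classical
  induction s using Finset.induction_on with
  | empty => simp [Lf_zero]
  | insert a s ha ih =>
    simp only [Finset.sum_insert ha]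
    rw [Lf_add, ih]

lemma Lf_hasSum (ν : ℝ) (n : ℕ) : ∀ (F : ℕ → ℕ → ℝ) (g : ℕ → ℝ),
    (∀ k, HasSum (fun m => F m k) (g k)) → HasSum (fun m => Lf ν n (F m)) (Lf ν n g) := by
  induction n with
  | zero => intro F g h; exact h 0
  | succ n ih =>
    intro F g h
    simp only [Lf]
    apply ih
    intro k
    exact ((h k).mul_left _).add ((h (k+1)).mul_left _)

noncomputable def Pf (n : ℕ) (s : ℝ) : ℝ := ∏ j ∈ Finset.range n, (1 + s / (j + 1))

lemma Lf_choose (ν : ℝ) (m n : ℕ) :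
    Lf ν n (fun k => ((m + k).choose k : ℝ)) = Pf n (m * ν) := by
  induction n with
  | zero => simp [Lf, Pf]
  | succ n ih =>
    have : (fun k : ℕ => (1 - ν * (k + 1) / (n + 1)) * ((m + k).choose k : ℝ)
        + ν * (k + 1) / (n + 1) * ((m + (k + 1)).choose (k + 1) : ℝ))
        = fun k => (1 + m * ν / (n + 1)) * ((m + k).choose k : ℝ) := by
      ext k
      have h : ((m + k + 1 : ℕ) : ℝ) * ((m + k).choose k : ℝ)
          = ((m + k + 1).choose (k + 1) : ℝ) * ((k + 1 : ℕ) : ℝ) := by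
        exact_mod_cast Nat.add_one_mul_choose_eq (m + k) k
      push_cast at h
      rw [← add_assoc]
      have e : ν * ((k:ℝ) + 1) / (n + 1) * ((m + k + 1).choose (k + 1) : ℝ)
        = ν / (n + 1) * (((m + k + 1).choose (k + 1) : ℝ) * (k + 1)) := by ring
      rw [e, ← h]
      ring
    simp only [Lf]
    rw [this, Lf_mul, ih, Pf, Pf, Finset.prod_range_succ, mul_comm]

lemma Lf_gen (ν z : ℝ) (hz : |z| < 1) (n : ℕ) :
    HasSum (fun m : ℕ => z ^ m * Pf n (m * ν)) (Lf ν n (fun k => 1 / (1 - z) ^ (k + 1))) := by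
  have := Lf_hasSum ν n (fun m k => z ^ m * ((m + k).choose k : ℝ)) (fun k => 1 / (1 - z) ^ (k + 1))
    (fun k => by
      have := hasSum_choose_mul_geometric_of_norm_lt_one (𝕜 := ℝ) k (r := z) (by simpa using hz)
      simpa [mul_comm] using this)
  simpa only [Lf_mul, Lf_choose] using this

lemma Pf_pos (n : ℕ) (s : ℝ) (hs : 0 ≤ s) : 0 < Pf n s := by
  unfold Pf
  apply Finset.prod_pos
  intros; positivity

noncomputable def af (ν : ℝ) (n m : ℕ) : ℝ := Pf n (m * ν) / ((n : ℝ) ^ ν) ^ m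

lemma af_nonneg (ν : ℝ) (h0 : 0 < ν) (n m : ℕ) : 0 ≤ af ν n m := by
  have := Pf_pos n (m * ν) (by positivity)
  unfold af; positivity

lemma af_tendsto (ν : ℝ) (h0 : 0 < ν) (m : ℕ) :
    Filter.Tendsto (fun n => af ν n m) Filter.atTop (nhds (1 / Real.Gamma (m * ν + 1))) := by
  rcases Nat.eq_zero_or_pos m with rfl | hm
  · simp [af, Pf]
  have hs : 0 < (m : ℝ) * ν := by positivity
  set s := (m : ℝ) * ν with hsd
  have h := ((Real.GammaSeq_tendsto_Gamma s).const_mul s).inv₀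
    (by rw [← Real.Gamma_add_one hs.ne']; exact (Real.Gamma_pos_of_pos (by positivity)).ne')
  rw [← Real.Gamma_add_one hs.ne'] at h
  rw [one_div]
  refine h.congr' ?_
  filter_upwards [Filter.eventually_ge_atTop 1] with n hn
  have hn' : (0 : ℝ) < n := by exact_mod_cast hn
  have e1 : ((n : ℝ) ^ ν) ^ m = (n : ℝ) ^ s := by
    rw [← Real.rpow_natCast, ← Real.rpow_mul hn'.le, mul_comm]
  have e2 : Pf n s * (n.factorial : ℝ) = ∏ j ∈ Finset.range n, (s + (j + 1 : ℕ)) := by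
    rw [← Finset.prod_range_add_one_eq_factorial, Pf]
    push_cast
    rw [← Finset.prod_mul_distrib]
    apply Finset.prod_congr rfl
    intro j _
    have : (j : ℝ) + 1 ≠ 0 := by positivity
    field_simp
    ring
  have hf : (n.factorial : ℝ) ≠ 0 := by positivity
  have hp := (Pf_pos n s hs.le).ne'
  have hr : (n : ℝ) ^ s ≠ 0 := by positivity
  unfold af Real.GammaSeq
  rw [← hsd, e1, Finset.prod_range_succ', ← e2]
  simp only [Nat.cast_zero, add_zero]
  field_simp

lemma af_anti (ν : ℝ) (h0 : 0 < ν) (m : ℕ) (hm : 1 ≤ (m : ℝ) * ν) (n0 n : ℕ) (h1 : 1 ≤ n0)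
    (h : n0 ≤ n) : af ν n m ≤ af ν n0 m := by
  induction n, h using Nat.le_induction with
  | base => exact le_rfl
  | succ n hn ih =>
    refine le_trans ?_ ih
    have hn' : (0 : ℝ) < n := by exact_mod_cast (by omega : 0 < n)
    have e : ∀ x : ℝ, 0 ≤ x → (x ^ ν) ^ m = x ^ ((m : ℝ) * ν) := by
      intro x hx
      rw [← Real.rpow_natCast, ← Real.rpow_mul hx, mul_comm]
    unfold af
    rw [e _ (by positivity), e _ (by positivity)]
    set s := (m : ℝ) * ν
    have hP : Pf (n + 1) s = Pf n s * (1 + s / (n + 1)) := by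
      rw [Pf, Finset.prod_range_succ, Pf]
    rw [hP]
    have hb := one_add_mul_self_le_rpow_one_add (s := 1 / (n : ℝ)) (p := s)
      (by have : 0 ≤ 1 / (n : ℝ) := by positivity
          linarith) hm
    have e3 : ((n + 1 : ℕ) : ℝ) ^ s = (n : ℝ) ^ s * (1 + 1 / (n : ℝ)) ^ s := by
      rw [← Real.mul_rpow (by positivity) (by positivity)]
      congr 1
      push_cast; field_simp
    have hc : s / ((n : ℝ) + 1) ≤ s * (1 / n) := by
      rw [mul_one_div]
      gcongr
      linarith
    have hp := Pf_pos n s (by linarith)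
    rw [e3, div_le_div_iff₀ (by positivity) (by positivity)]
    have : 1 + s / ((n : ℝ) + 1) ≤ (1 + 1 / (n : ℝ)) ^ s := by linarith
    calc Pf n s * (1 + s / ((n : ℝ) + 1)) * (n : ℝ) ^ s
        ≤ Pf n s * ((1 + 1 / (n : ℝ)) ^ s) * (n : ℝ) ^ s := by gcongr
      _ = _ := by ring

lemma scale_tendsto (x ν : ℝ) (h0 : 0 < ν) :
    Filter.Tendsto (fun n : ℕ => (1 - Real.exp (-(x / (n : ℝ) ^ ν))) * (n : ℝ) ^ ν)
      Filter.atTop (nhds x) := by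
  have hN : Filter.Tendsto (fun n : ℕ => (n : ℝ) ^ ν) Filter.atTop Filter.atTop :=
    (tendsto_rpow_atTop h0).comp tendsto_natCast_atTop_atTop
  have hd : HasDerivAt (fun y : ℝ => 1 - Real.exp (-(x * y))) x 0 := by
    have := ((((hasDerivAt_id (0 : ℝ)).const_mul x).neg).exp).const_sub 1
    simpa using this
  have hs := hd.tendsto_slope_zero_right
  have hinv : Filter.Tendsto (fun n : ℕ => ((n : ℝ) ^ ν)⁻¹) Filter.atTop (nhdsWithin 0 (Set.Ioi 0)) :=
    tendsto_inv_atTop_nhdsGT_zero.comp hN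
  refine (hs.comp hinv).congr ?_
  intro n
  simp [div_eq_mul_inv, mul_comm]

lemma Lf_ML (ν x : ℝ) (h0 : 0 < ν) :
    Filter.Tendsto (fun n : ℕ => Lf ν n (fun k => Real.exp (x * ((k + 1) / (n : ℝ) ^ ν))))
      Filter.atTop (nhds (ML ν x)) := by
  have hN : Filter.Tendsto (fun n : ℕ => (n : ℝ) ^ ν) Filter.atTop Filter.atTop :=
    (tendsto_rpow_atTop h0).comp tendsto_natCast_atTop_atTop
  set z : ℕ → ℝ := fun n => 1 - Real.exp (-(x / (n : ℝ) ^ ν)) with hz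
  have hzt := scale_tendsto x ν h0
  set y := |x| + 1 with hy
  have hypos : 0 < y := by positivity
  have hev1 : ∀ᶠ n : ℕ in Filter.atTop, |z n * (n : ℝ) ^ ν| < y := by
    have := hzt.abs
    exact this.eventually_lt_const (by rw [hy]; linarith)
  have hev2 : ∀ᶠ n : ℕ in Filter.atTop, y < (n : ℝ) ^ ν := hN.eventually_gt_atTop y
  obtain ⟨n0, hn0⟩ := Filter.eventually_atTop.1 ((hev1.and hev2).and (Filter.eventually_ge_atTop 1))
  obtain ⟨M, hM⟩ := exists_nat_ge (1 / ν)
  have hA : ∀ m, ∃ A, ∀ n, af ν n m ≤ A := by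
    intro m
    obtain ⟨A, hA⟩ := (af_tendsto ν h0 m).bddAbove_range
    exact ⟨A, fun n => hA ⟨n, rfl⟩⟩
  choose A hA using hA
  have heq : ∀ n ≥ n0, Lf ν n (fun k => Real.exp (x * ((k + 1) / (n : ℝ) ^ ν)))
      = ∑' m : ℕ, (z n * (n : ℝ) ^ ν) ^ m * af ν n m := by
    intro n hn
    obtain ⟨⟨g1, g2⟩, g3⟩ := hn0 n hn
    have hpos : 0 < (n : ℝ) ^ ν := by linarith
    have hz1 : |z n| < 1 := by
      rw [abs_mul, abs_of_pos hpos] at g1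
      by_contra hc
      push Not at hc
      nlinarith
    have := (Lf_gen ν (z n) hz1 n).tsum_eq
    have e1 : (fun k : ℕ => 1 / (1 - z n) ^ (k + 1)) =
        (fun k : ℕ => Real.exp (x * ((k + 1) / (n : ℝ) ^ ν))) := by
      ext k
      simp only [hz]
      rw [sub_sub_cancel, ← Real.exp_nat_mul, one_div, ← Real.exp_neg]
      congr 1
      push_cast; ring
    rw [e1] at this
    rw [← this]
    apply tsum_congr
    intro m
    unfold af
    rw [mul_pow]
    have : ((n : ℝ) ^ ν) ^ m ≠ 0 := by positivity
    field_simp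
  have hML : ML ν x = ∑' m : ℕ, x ^ m * (1 / Real.Gamma (m * ν + 1)) := by
    unfold ML
    apply tsum_congr
    intro m
    rw [mul_one_div]
  rw [hML]
  have hlim : Filter.Tendsto (fun n => ∑' m : ℕ, (z n * (n : ℝ) ^ ν) ^ m * af ν n m) Filter.atTop
      (nhds (∑' m : ℕ, x ^ m * (1 / Real.Gamma (m * ν + 1)))) := by
    refine tendsto_tsum_of_dominated_convergence
      (bound := fun m => if m < M then y ^ m * A m else y ^ m * af ν n0 m) ?_ ?_ ?_
    · have hs : Summable (fun m => y ^ m * af ν n0 m) := by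
        obtain ⟨⟨g1, g2⟩, g3⟩ := hn0 n0 le_rfl
        have hpos : 0 < (n0 : ℝ) ^ ν := by linarith
        have := (Lf_gen ν (y / (n0 : ℝ) ^ ν)
          (by rw [abs_of_pos (by positivity), div_lt_one hpos]; exact g2) n0).summable
        refine this.congr ?_
        intro m
        unfold af
        rw [div_pow]; ring
      rw [← summable_nat_add_iff M] at hs ⊢
      refine hs.congr ?_
      intro m
      simp
    · intro m
      exact (hzt.pow m).mul (af_tendsto ν h0 m)
    · filter_upwards [Filter.eventually_ge_atTop n0] with n hn m
      obtain ⟨⟨g1, g2⟩, g3⟩ := hn0 n hn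
      rw [norm_mul, norm_pow, Real.norm_eq_abs, Real.norm_eq_abs, abs_of_nonneg (af_nonneg ν h0 n m)]
      have := af_nonneg ν h0 n m
      split_ifs with hm
      · have := hA m n
        gcongr
      · have hm1 : 1 ≤ (m : ℝ) * ν := by
          have : (M : ℝ) ≤ m := by exact_mod_cast not_lt.1 hm
          rw [← div_le_iff₀ h0]
          linarith
        have := af_anti ν h0 m hm1 n0 n (hn0 n0 le_rfl).2 hn
        gcongr
  refine hlim.congr' ?_
  filter_upwards [Filter.eventually_ge_atTop n0] with n hn
  exact (heq n hn).symm

/- pointwise part -/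
noncomputable def If (α s c : ℝ) : ℝ := α / (α - c) * (Real.exp (-c * s) - Real.exp (-α * s))

lemma If_int (α s c : ℝ) (h : c ≠ α) :
    ∫ u in (0 : ℝ)..s, α * Real.exp (-α * (s - u)) * Real.exp (-c * u) = If α s c := by
  have hne : α - c ≠ 0 := sub_ne_zero.2 h.symm
  have e : ∀ u : ℝ, HasDerivAt (fun u => α / (α - c) * (Real.exp (-α * (s - u)) * Real.exp (-c * u)))
      (α * Real.exp (-α * (s - u)) * Real.exp (-c * u)) u := by
    intro u
    have h1 : HasDerivAt (fun u => Real.exp (-α * (s - u))) (Real.exp (-α * (s - u)) * α) u := by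
      have := (((hasDerivAt_id u).const_sub s).const_mul (-α)).exp
      simpa using this
    have h2 : HasDerivAt (fun u => Real.exp (-c * u)) (Real.exp (-c * u) * -c) u := by
      have := ((hasDerivAt_id u).const_mul (-c)).exp
      simpa using this
    refine ((h1.mul h2).const_mul (α / (α - c))).congr_deriv ?_
    field_simp
    ring
  rw [intervalIntegral.integral_eq_sub_of_hasDerivAt (fun u _ => e u)
    (by apply Continuous.intervalIntegrable; fun_prop)]
  unfold If
  simp
  ring

noncomputable def qf (α lam : ℝ) (m : ℕ) (s : ℝ) : ℝ :=
  ∑ j ∈ Finset.range (m + 1), ((m.choose j : ℝ) * (-1) ^ j) * If α s ((j + 1) * lam)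

lemma qf_int (α lam : ℝ) (hne : ∀ k : ℕ, 1 ≤ k → (k : ℝ) * lam ≠ α) (m : ℕ) (s : ℝ) :
    qf α lam m s = ∫ u in (0 : ℝ)..s, α * Real.exp (-α * (s - u)) *
      (Real.exp (-lam * u) * (1 - Real.exp (-lam * u)) ^ m) := by
  have h1 : ∀ u : ℝ, α * Real.exp (-α * (s - u)) *
      (Real.exp (-lam * u) * (1 - Real.exp (-lam * u)) ^ m) =
      ∑ j ∈ Finset.range (m + 1), ((m.choose j : ℝ) * (-1) ^ j) *
        (α * Real.exp (-α * (s - u)) * Real.exp (-((j + 1) * lam) * u)) := by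
    intro u
    have : (1 - Real.exp (-lam * u)) ^ m = ∑ j ∈ Finset.range (m + 1),
        (m.choose j : ℝ) * (-1) ^ j * Real.exp (-lam * u) ^ j := by
      rw [sub_eq_neg_add, add_pow]
      apply Finset.sum_congr rfl
      intro j _
      rw [neg_pow]; simp; ring
    rw [this, Finset.mul_sum, Finset.mul_sum]
    apply Finset.sum_congr rfl
    intro j _
    have : Real.exp (-((j + 1) * lam) * u) = Real.exp (-lam * u) ^ (j + 1) := by
      rw [← Real.exp_nat_mul]; congr 1; push_cast; ring
    rw [this]; ring
  simp_rw [h1]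
  rw [intervalIntegral.integral_finsetSum
    (fun j _ => by apply Continuous.intervalIntegrable; fun_prop)]
  unfold qf
  apply Finset.sum_congr rfl
  intro j _
  rw [intervalIntegral.integral_const_mul, If_int]
  have := hne (j + 1) (by omega)
  push_cast at this
  exact this

lemma geo_bound (q : ℝ) (h0 : 0 < q) (h1 : q ≤ 1) (M : ℕ) :
    ∑ m ∈ Finset.range M, ((m : ℝ) + 1) * (q * (1 - q) ^ m) ≤ q⁻¹ ∧
    q⁻¹ - 2 / ((M : ℝ) + 1) * (q⁻¹) ^ 2 ≤
      ∑ m ∈ Finset.range M, ((m : ℝ) + 1) * (q * (1 - q) ^ m) := by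
  have hr : ‖1 - q‖ < 1 := by
    rw [Real.norm_eq_abs, abs_lt]; constructor <;> linarith
  have hr0 : 0 ≤ 1 - q := by linarith
  have g1 : HasSum (fun m : ℕ => ((m : ℝ) + 1) * (q * (1 - q) ^ m)) q⁻¹ := by
    have := (hasSum_choose_mul_geometric_of_norm_lt_one (𝕜 := ℝ) 1 hr).mul_left q
    have e : q * (1 / (1 - (1 - q)) ^ (1 + 1)) = q⁻¹ := by rw [sub_sub_cancel]; field_simp
    rw [e] at this
    refine (congrArg (fun f => HasSum f _) (funext ?_)).mpr this
    intro m; simp; ring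
  have g2 : HasSum (fun m : ℕ => ((m : ℝ) + 1) * (m + 2) * (q * (1 - q) ^ m)) (2 * (q⁻¹) ^ 2) := by
    have := (hasSum_choose_mul_geometric_of_norm_lt_one (𝕜 := ℝ) 2 hr).mul_left (2 * q)
    have e : 2 * q * (1 / (1 - (1 - q)) ^ (2 + 1)) = 2 * (q⁻¹) ^ 2 := by
      rw [sub_sub_cancel]; field_simp
    rw [e] at this
    refine (congrArg (fun f => HasSum f _) (funext ?_)).mpr this
    intro m
    rw [Nat.cast_choose_two]
    push_cast; ring
  refine ⟨sum_le_hasSum _ (fun m _ => by positivity) g1, ?_⟩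
  have g3 := g1.sub (g2.mul_left (1 / ((M : ℝ) + 1)))
  have g4 : HasSum (fun m : ℕ => if m ∈ Finset.range M then ((m : ℝ) + 1) * (q * (1 - q) ^ m) else 0)
      (∑ m ∈ Finset.range M, if m ∈ Finset.range M then ((m : ℝ) + 1) * (q * (1 - q) ^ m) else 0) :=
    hasSum_sum_of_ne_finset_zero (fun m hm => by simp only [hm, if_false])
  rw [Finset.sum_congr rfl (fun m hm => if_pos hm)] at g4
  have := hasSum_le (fun m => ?_) g3 g4
  · calc _ = _ := by ring
      _ ≤ _ := this
  · have hp : 0 ≤ q * (1 - q) ^ m := by positivity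
    split_ifs with hm
    · have : 0 ≤ 1 / ((M : ℝ) + 1) * (((m : ℝ) + 1) * (m + 2) * (q * (1 - q) ^ m)) := by positivity
      linarith
    · have hm' : (M : ℝ) ≤ m := by
        rw [Finset.mem_range, not_lt] at hm; exact_mod_cast hm
      have h2 : 1 ≤ 1 / ((M : ℝ) + 1) * (m + 2) := by
        rw [one_div_mul_eq_div, one_le_div (by positivity)]; linarith
      have h3 : 0 ≤ ((m : ℝ) + 1) * (q * (1 - q) ^ m) := by positivity
      nlinarith

lemma qf_bounds (α lam : ℝ) (hα : 0 < α) (hlam : 0 < lam)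
    (hne : ∀ k : ℕ, 1 ≤ k → (k : ℝ) * lam ≠ α) (s : ℝ) (hs : 0 ≤ s) :
    (∀ m, 0 ≤ qf α lam m s) ∧ ∀ M : ℕ,
      (∑ m ∈ Finset.range M, ((m : ℝ) + 1) * qf α lam m s ≤ If α s (-lam)) ∧
      If α s (-lam) - 2 / ((M : ℝ) + 1) * If α s (-(2 * lam)) ≤
        ∑ m ∈ Finset.range M, ((m : ℝ) + 1) * qf α lam m s := by
  have hq : ∀ u : ℝ, 0 ≤ u → Real.exp (-lam * u) ≤ 1 := by
    intro u hu
    rw [Real.exp_le_one_iff]; nlinarith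
  constructor
  · intro m
    rw [qf_int α lam hne]
    apply intervalIntegral.integral_nonneg hs
    intro u hu
    have : 0 ≤ 1 - Real.exp (-lam * u) := by linarith [hq u hu.1]
    positivity
  intro M
  have hS : ∑ m ∈ Finset.range M, ((m : ℝ) + 1) * qf α lam m s =
      ∫ u in (0 : ℝ)..s, α * Real.exp (-α * (s - u)) *
        ∑ m ∈ Finset.range M, ((m : ℝ) + 1) * (Real.exp (-lam * u) * (1 - Real.exp (-lam * u)) ^ m) := by
    simp_rw [Finset.mul_sum]
    rw [intervalIntegral.integral_finsetSum
      (fun j _ => by apply Continuous.intervalIntegrable; fun_prop)]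
    apply Finset.sum_congr rfl
    intro m _
    rw [qf_int α lam hne, ← intervalIntegral.integral_const_mul]
    congr 1; ext u; ring
  have hI1 := If_int α s (-lam) (by linarith)
  have hI2 := If_int α s (-(2 * lam)) (by linarith)
  have e1 : ∀ u, (Real.exp (-lam * u))⁻¹ = Real.exp (- -lam * u) := by
    intro u; rw [← Real.exp_neg]; congr 1; ring
  have e2 : ∀ u, (Real.exp (-lam * u))⁻¹ ^ 2 = Real.exp (- -(2 * lam) * u) := by
    intro u; rw [← Real.exp_neg, ← Real.exp_nat_mul]; congr 1; push_cast; ring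
  rw [hS, ← hI1, ← hI2]
  constructor
  · apply intervalIntegral.integral_mono_on hs
      (by apply Continuous.intervalIntegrable; fun_prop)
      (by apply Continuous.intervalIntegrable; fun_prop)
    intro u hu
    have := (geo_bound _ (Real.exp_pos (-lam * u)) (hq u hu.1) M).1
    rw [e1] at this
    gcongr
  · rw [← intervalIntegral.integral_const_mul, ← intervalIntegral.integral_sub
      (by apply Continuous.intervalIntegrable; fun_prop)
      (by apply Continuous.intervalIntegrable; fun_prop)]
    apply intervalIntegral.integral_mono_on hs
      (by apply Continuous.intervalIntegrable; fun_prop)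
      (by apply Continuous.intervalIntegrable; fun_prop)
    intro u hu
    have := (geo_bound _ (Real.exp_pos (-lam * u)) (hq u hu.1) M).2
    rw [e2, e1] at this
    calc _ = α * Real.exp (-α * (s - u)) * (Real.exp (- -lam * u) -
          2 / ((M : ℝ) + 1) * Real.exp (- -(2 * lam) * u)) := by ring
      _ ≤ _ := by gcongr

/- assembling -/
noncomputable def JJ (ν α x c : ℝ) : ℝ := α / (α - c) * (ML ν (-c * x) - ML ν (-α * x))

lemma If_tendsto (ν α x c : ℝ) (h0 : 0 < ν) :
    Filter.Tendsto (fun n : ℕ => Lf ν n (fun k => If α (x * ((k + 1) / (n : ℝ) ^ ν)) c))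
      Filter.atTop (nhds (JJ ν α x c)) := by
  unfold If JJ
  simp only [Lf_mul, Lf_sub]
  have h := ((Lf_ML ν (-c * x) h0).sub (Lf_ML ν (-α * x) h0)).const_mul (α / (α - c))
  simpa only [mul_assoc] using h

noncomputable def QQ (ν α lam x : ℝ) (m : ℕ) : ℝ :=
  ∑ j ∈ Finset.range (m + 1), ((m.choose j : ℝ) * (-1) ^ j) * JJ ν α x ((j + 1) * lam)

lemma qf_tendsto (ν α lam x : ℝ) (h0 : 0 < ν) (m : ℕ) :
    Filter.Tendsto (fun n : ℕ => Lf ν n (fun k => qf α lam m (x * ((k + 1) / (n : ℝ) ^ ν))))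
      Filter.atTop (nhds (QQ ν α lam x m)) := by
  unfold qf QQ
  simp only [Lf_sum, Lf_mul]
  exact tendsto_finsetSum _ (fun j _ => (If_tendsto ν α x _ h0).const_mul _)

lemma QQ_eq (ν α lam t : ℝ) (m : ℕ) : pbar ν α lam (m + 1) t = QQ ν α lam (t ^ ν) m := by
  unfold pbar QQ JJ
  rw [if_neg (by omega), ← Finset.Ico_add_one_right_eq_Icc, Finset.sum_Ico_eq_sum_range]
  apply Finset.sum_congr (by simp)
  intro j _
  rw [show 1 + j - 1 = j by omega, show m + 1 - 1 = m by omega]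
  have e : α / (((1 + j : ℕ) : ℝ) * lam - α) = - (α / (α - ((j : ℝ) + 1) * lam)) := by
    rw [← div_neg]; congr 1; push_cast; ring
  rw [e, pow_add]
  push_cast
  rw [add_comm 1 (j : ℝ)]
  ring

/-- Mean of the TFLBPwI: `∑_{n≥1} n p̄(n,t) = (α/(α+λ))(E_ν(λt^ν) − E_ν(−αt^ν))`.
(The `n = 0` term of the series is zero, so the sum over all `n : ℕ` coincides with
the sum from `n = 1`.) -/
theorem pbar_mean (ν α lam : ℝ) (hν0 : 0 < ν) (hν1 : ν ≤ 1) (hα : 0 < α)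
    (hlam : 0 < lam) (hne : ∀ k : ℕ, 1 ≤ k → (k : ℝ) * lam ≠ α) (t : ℝ) (ht : 0 ≤ t) :
    HasSum (fun n : ℕ => (n : ℝ) * pbar ν α lam n t)
      ((α / (α + lam)) * (ML ν (lam * t ^ ν) - ML ν (-α * t ^ ν))) := by
  rw [← hasSum_nat_add_iff' 1]
  simp only [QQ_eq, Finset.range_one, Finset.sum_singleton, Nat.cast_zero, zero_mul, sub_zero]
  have hx : 0 ≤ t ^ ν := Real.rpow_nonneg ht ν
  set x := t ^ ν
  have eJ : (α / (α + lam)) * (ML ν (lam * x) - ML ν (-α * x)) = JJ ν α x (-lam) := by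
    unfold JJ; simp
  rw [eJ]
  have hb : ∀ n k : ℕ, 0 ≤ x * (((k : ℝ) + 1) / (n : ℝ) ^ ν) := by intros; positivity
  have hnn : ∀ m, 0 ≤ QQ ν α lam x m := by
    intro m
    refine ge_of_tendsto' (qf_tendsto ν α lam x hν0 m) (fun n => ?_)
    rw [← Lf_zero ν n]
    exact Lf_mono ν hν0 hν1 n _ _ (fun k => (qf_bounds α lam hα hlam hne _ (hb n k)).1 m)
  have hS : ∀ M : ℕ, Filter.Tendsto (fun n : ℕ => Lf ν n (fun k =>
      ∑ m ∈ Finset.range M, ((m : ℝ) + 1) * qf α lam m (x * ((k + 1) / (n : ℝ) ^ ν))))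
      Filter.atTop (nhds (∑ m ∈ Finset.range M, ((m : ℝ) + 1) * QQ ν α lam x m)) := by
    intro M
    simp only [Lf_sum, Lf_mul]
    exact tendsto_finsetSum _ (fun j _ => (qf_tendsto ν α lam x hν0 _).const_mul _)
  have hup : ∀ M : ℕ, ∑ m ∈ Finset.range M, ((m : ℝ) + 1) * QQ ν α lam x m ≤ JJ ν α x (-lam) := by
    intro M
    refine le_of_tendsto_of_tendsto' (hS M) (If_tendsto ν α x (-lam) hν0) (fun n => ?_)
    exact Lf_mono ν hν0 hν1 n _ _ (fun k => ((qf_bounds α lam hα hlam hne _ (hb n k)).2 M).1)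
  have hlo : ∀ M : ℕ, JJ ν α x (-lam) - 2 / ((M : ℝ) + 1) * JJ ν α x (-(2 * lam)) ≤
      ∑ m ∈ Finset.range M, ((m : ℝ) + 1) * QQ ν α lam x m := by
    intro M
    refine le_of_tendsto_of_tendsto' ((If_tendsto ν α x (-lam) hν0).sub
      ((If_tendsto ν α x (-(2 * lam)) hν0).const_mul _)) (hS M) (fun n => ?_)
    rw [← Lf_mul, ← Lf_sub]
    exact Lf_mono ν hν0 hν1 n _ _ (fun k => ((qf_bounds α lam hα hlam hne _ (hb n k)).2 M).2)
  push_cast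
  rw [hasSum_iff_tendsto_nat_of_nonneg (fun m => mul_nonneg (by positivity) (hnn m))]
  refine tendsto_of_tendsto_of_tendsto_of_le_of_le ?_ tendsto_const_nhds hlo hup
  have h2 : Filter.Tendsto (fun M : ℕ => 2 / ((M : ℝ) + 1)) Filter.atTop (nhds 0) := by
    have := (tendsto_one_div_add_atTop_nhds_zero_nat (𝕜 := ℝ)).const_mul 2
    simpa [div_eq_mul_inv] using this
  have := (h2.mul_const (JJ ν α x (-(2 * lam)))).const_sub (JJ ν α x (-lam))
  simpa using this
end
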